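/- Let K_f := ℚ[X]/(X^5 − X − 1), a degree-5 number field, and let L := K_f[Y]/(Y² + 151), a degree-10 number field. Then the class number of L equals 7. -/

import Mathlib

open Polynomial

/-- Coefficient vectors `c₀ + c₁ X + c₂ X² + c₃ X³ + c₄ X⁴` of elements of `α[X] / (X⁵ - X - 1)`. -/
@[ext]
structure Quint (α : Type*) where
  (c₀ c₁ c₂ c₃ c₄ : α)

namespace Quint

/-- Multiplication modulo `X⁵ - X - 1`. -/
def mul {α : Type*} [Add α] [Mul α] (x y : Quint α) : Quint α :=
  let r₅ := x.c₁ * y.c₄ + x.c₂ * y.c₃ + x.c₃ * y.c₂ + x.c₄ * y.c₁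
  let r₆ := x.c₂ * y.c₄ + x.c₃ * y.c₃ + x.c₄ * y.c₂
  let r₇ := x.c₃ * y.c₄ + x.c₄ * y.c₃
  let r₈ := x.c₄ * y.c₄
  ⟨x.c₀ * y.c₀ + r₅,
    x.c₀ * y.c₁ + x.c₁ * y.c₀ + r₅ + r₆,
    x.c₀ * y.c₂ + x.c₁ * y.c₁ + x.c₂ * y.c₀ + r₆ + r₇,
    x.c₀ * y.c₃ + x.c₁ * y.c₂ + x.c₂ * y.c₁ + x.c₃ * y.c₀ + r₇ + r₈,
    x.c₀ * y.c₄ + x.c₁ * y.c₃ + x.c₂ * y.c₂ + x.c₃ * y.c₁ + x.c₄ * y.c₀ + r₈⟩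

def add {α : Type*} [Add α] (x y : Quint α) : Quint α :=
  ⟨x.c₀ + y.c₀, x.c₁ + y.c₁, x.c₂ + y.c₂, x.c₃ + y.c₃, x.c₄ + y.c₄⟩

/-- Multiplication by `X` modulo `X⁵ - X - 1`. -/
def shift {α : Type*} [Add α] (x : Quint α) : Quint α :=
  ⟨x.c₄, x.c₀ + x.c₄, x.c₁, x.c₂, x.c₃⟩

/-- Reduction of the coefficients modulo `p`. -/
def red (p : ℕ) (x : Quint ℕ) : Quint ℕ :=
  ⟨x.c₀ % p, x.c₁ % p, x.c₂ % p, x.c₃ % p, x.c₄ % p⟩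

/-- The nonnegative residues modulo `p` of integral coefficients. -/
def redInt (p : ℕ) (x : Quint ℤ) : Quint ℕ :=
  ⟨(x.c₀ % p).toNat, (x.c₁ % p).toNat, (x.c₂ % p).toNat, (x.c₃ % p).toNat, (x.c₄ % p).toNat⟩

/-- `X ^ e` modulo `p` and `X⁵ - X - 1`, for `e < 2 ^ i`, by repeated squaring. -/
def powX (p : ℕ) : ℕ → ℕ → Quint ℕ
  | 0, _ => ⟨1, 0, 0, 0, 0⟩
  | i + 1, e =>
    let r := powX p i (e / 2)
    let s := red p (mul r r)
    bif e % 2 == 1 then shift s else s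

/-- The coefficient vector given by the base `b` digits of `n`. -/
def unpack (b n : ℕ) : Quint ℕ :=
  ⟨n % b, n / b % b, n / b ^ 2 % b, n / b ^ 3 % b, n / b ^ 4 % b⟩

/-- The coefficient vector given by the base `5` digits of `n`, shifted to `-2, …, 2`. -/
def unpackInt (n : ℕ) : Quint ℤ :=
  ⟨(n % 5 : ℕ) - 2, (n / 5 % 5 : ℕ) - 2, (n / 25 % 5 : ℕ) - 2, (n / 125 % 5 : ℕ) - 2,
    (n / 625 % 5 : ℕ) - 2⟩

/-- The norm form of `ℤ[X] / (X⁵ - X - 1)`. -/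
def norm : Quint ℤ → ℤ
  | ⟨a, b, c, d, e⟩ =>
    ((((a + 4 * e) * a + (-4 * d - 5 * e) * b + (-2 * c - 5 * d) * c + (6 * e) * e) * a + ((4 * c
    + 5 * d) * b + (5 * c) * c + (-8 * e) * d + (-11 * e) * e) * b + ((-4 * e) * c + (4 * d - 2 *
    e) * d + (5 * e) * e) * c + ((3 * d + 5 * e) * d) * d + ((4 * e) * e) * e) * a + (((-b - 5 *
    c) * b + (4 * e) * c + (2 * d + 13 * e) * d + (5 * e) * e) * b + ((-4 * d + 3 * e) * c + (-7 *
    d - 5 * e) * d) * c + ((-5 * d) * d + (-4 * e) * e) * d + ((-7 * e) * e) * e) * b + (((c + d -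
    5 * e) * c + (5 * d) * d + (-2 * e) * e) * c + ((4 * e) * d + (3 * e) * e) * d + ((6 * e) * e)
    * e) * c + (((-d - e) * d - e * e) * d + ((-5 * e) * e) * e) * d + ((e * e) * e) * e) * a +
    (((b * b + (-4 * e) * c + (-2 * d - 5 * e) * d) * b + ((4 * d + 5 * e) * c + (5 * d) * d) * c
    + ((4 * e) * e) * d + ((3 * e) * e) * e) * b + (((-c - 5 * d) * c + (2 * e) * e) * c + ((-4 *
    e) * d + (-7 * e) * e) * d + ((-5 * e) * e) * e) * c + (((d + e) * d + (5 * e) * e) * d) * d +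
    (((-e) * e) * e) * e) * b + (((c * c + (-2 * e) * e) * c + ((4 * e) * d + (5 * e) * e) * d) *
    c + (((-d - 5 * e) * d) * d) * d + ((e * e) * e) * e) * c + (((d * d) * d) * d + (((-e) * e) *
    e) * e) * d + (((e * e) * e) * e) * e

end Quint

open Quint in
/-- The norm form of the quadratic algebra `Y² - sY + n` over `ℤ[X] / (X⁵ - X - 1)`, where
`s = 1 - X² - X³ + X⁴` and `n = 1 - X + X² + 4X³ - 2X⁴`. -/
def relNorm (x y : Quint ℤ) : Quint ℤ :=
  ((x.mul x).add ((x.mul y).mul ⟨1, 0, -1, -1, 1⟩)).add ((y.mul y).mul ⟨1, -1, 1, 4, -2⟩)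

/-- Data certifying that the primes of residue field of cardinality `p ^ f` have a smooth element.

The code `c` stands for the element `x + y η` where the digits of `c` in base `5` are the
coefficients of `x` and `y`, shifted by `2`. The product of the relative norms of these elements is
`cofactor * (θ ^ p ^ f - θ)` modulo `p`, the coefficients of `cofactor` being packed in base `p`. -/
structure SmoothCert where
  (p f cofactor : ℕ)
  codes : List ℕ

namespace SmoothCert

/-- The relative norm of the element with the given code. -/
def codeNorm (c : ℕ) : Quint ℤ :=
  relNorm (Quint.unpackInt c) (Quint.unpackInt (c / 3125))

/-- If `q` divides `N`, then the prime powers dividing the quotient are less than `q`: the quotient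
is the product of two coprime numbers less than `q`. -/
def smoothNorm (q N : ℕ) : Bool :=
  let m := N / q
  let a := Nat.gcd m (2 ^ 20)
  let b := m / a
  N % q != 0 || (Nat.ble 1 m && Nat.beq (a * b) m && Nat.beq (Nat.gcd a b) 1 &&
    Nat.blt a q && Nat.blt b q)

/-- `X ^ q - X` modulo `p` and `X⁵ - X - 1`. -/
def frobSub (p q : ℕ) : Quint ℕ :=
  (Quint.powX p 13 q).add ⟨0, p - 1, 0, 0, 0⟩

def prodNorms (p : ℕ) : List ℕ → Quint ℕ
  | [] => ⟨1, 0, 0, 0, 0⟩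
  | c :: l => ((prodNorms p l).mul (Quint.redInt p (codeNorm c))).red p

def beq (x y : Quint ℕ) : Bool :=
  Nat.beq x.c₀ y.c₀ && Nat.beq x.c₁ y.c₁ && Nat.beq x.c₂ y.c₂ && Nat.beq x.c₃ y.c₃ &&
    Nat.beq x.c₄ y.c₄

/-- The verification of a certificate. -/
def check (t : SmoothCert) : Bool :=
  let q := t.p ^ t.f
  Nat.blt 0 t.p && Nat.blt q 8192 &&
  t.codes.all (fun c => smoothNorm q (Quint.norm (codeNorm c)).natAbs) &&
  beq (((Quint.unpack t.p t.cofactor).mul (frobSub t.p q)).red t.p)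
    ((prodNorms t.p t.codes).red t.p)

def tableA : List SmoothCert :=
  [⟨2, 1, 15, []⟩, ⟨2, 4, 3, [4882938]⟩, ⟨2, 5, 29, []⟩, ⟨2, 6, 0, [4882843, 4882814]⟩,
    ⟨2, 7, 15, []⟩, ⟨2, 8, 3, [4882843]⟩, ⟨2, 9, 2, [4882963]⟩, ⟨2, 10, 4, [4882843]⟩,
    ⟨2, 11, 29, []⟩, ⟨2, 12, 0, [4882843, 4882963]⟩, ⟨3, 2, 242, []⟩, ⟨3, 4, 147, []⟩,
    ⟨3, 6, 10, []⟩, ⟨5, 1, 1, []⟩, ⟨5, 2, 3, []⟩, ⟨5, 3, 2, []⟩, ⟨5, 4, 4, []⟩,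
    ⟨5, 5, 0, [5277937]⟩, ⟨7, 2, 118, [4886593]⟩, ⟨7, 4, 198, [4882966]⟩, ⟨11, 1, 100444, []⟩,
    ⟨11, 2, 144123, []⟩, ⟨11, 3, 41535, []⟩, ⟨13, 2, 71376, []⟩, ⟨17, 1, 998, [4885917, 5273563]⟩,
    ⟨17, 2, 265, [4883563, 4883438]⟩, ⟨17, 3, 0, [4885917, 5273563, 6837183]⟩,
    ⟨19, 1, 49640, [2929688]⟩, ⟨19, 2, 122652, [4882839]⟩, ⟨23, 2, 175953, [4881587]⟩,
    ⟨29, 1, 315075, [2929712]⟩, ⟨29, 2, 452594, [4882437]⟩, ⟨31, 1, 252305, [6836063]⟩,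
    ⟨31, 2, 902708, [4882819]⟩, ⟨37, 1, 10926093, []⟩, ⟨37, 2, 37738, [4885992]⟩,
    ⟨41, 2, 6449, [4883063, 4882863]⟩, ⟨43, 1, 50221, [4886587, 6835938]⟩,
    ⟨43, 2, 33628, [4882939, 4882844]⟩, ⟨47, 1, 67783, [4886567, 4885943]⟩,
    ⟨47, 2, 7411, [4883433, 4885967]⟩, ⟨53, 2, 86360, [4883688, 4883088]⟩, ⟨59, 1, 550118680, []⟩,
    ⟨59, 2, 108475, [5276592]⟩, ⟨61, 2, 8887524, [4882914]⟩,
    ⟨67, 2, 0, [3351562, 4896087, 3008437]⟩, ⟨71, 2, 0, [992187, 2945347, 4805439]⟩,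
    ⟨73, 2, 363120, [4964087]⟩, ⟨79, 2, 1427453336, []⟩, ⟨97, 1, 31652981, [4885963]⟩,
    ⟨103, 1, 2576604652, []⟩, ⟨127, 1, 92222849, [4867817]⟩, ⟨137, 1, 31593605555, []⟩,
    ⟨139, 1, 932931935, []⟩, ⟨151, 1, 145592, [4885837, 4901561]⟩, ⟨167, 1, 78548885361, []⟩,
    ⟨173, 1, 759565524, [4886063]⟩, ⟨191, 1, 305360, [4885944, 4960938]⟩,
    ⟨193, 1, 17911, [2933437, 4885942, 3320937]⟩, ⟨223, 1, 581675671, [4870937]⟩]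

theorem tableA_check : tableA.all check = true := by decide +kernel

def tableB : List SmoothCert :=
  [⟨227, 1, 12249, [4886067, 4886062, 4886562]⟩, ⟨229, 1, 5885941, [4508438, 4976563]⟩,
    ⟨239, 1, 601210282, [4885938]⟩, ⟨241, 1, 2226905357, [4885964]⟩,
    ⟨251, 1, 1050300613, [4964063]⟩, ⟨269, 1, 349116576, [4492942]⟩,
    ⟨307, 1, 35712, [4885813, 4886112, 4961064]⟩, ⟨311, 1, 16328026, [4886088, 2930312]⟩,
    ⟨313, 1, 5935681209, [2929813]⟩, ⟨331, 1, 11057797036, [4885937]⟩,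
    ⟨347, 1, 17052833, [5277187, 4962188]⟩, ⟨349, 1, 14308142, [4886588, 4885941]⟩,
    ⟨383, 1, 7722756448945, []⟩, ⟨397, 1, 6942974308401, []⟩, ⟨401, 1, 10302753036882, []⟩,
    ⟨439, 1, 1055191464, [5273433]⟩, ⟨457, 1, 72854129, [5289063, 3009062]⟩,
    ⟨461, 1, 8318721863738, []⟩, ⟨463, 1, 61698777, [5276563, 4961588]⟩,
    ⟨487, 1, 179825, [5351688, 4963437, 5276561]⟩, ⟨491, 1, 37096573498, [4885892]⟩,
    ⟨503, 1, 26822153511148, []⟩, ⟨521, 1, 8095353614, [5274688]⟩,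
    ⟨541, 1, 28572541697, [4492812]⟩, ⟨547, 1, 32795276854381, []⟩,
    ⟨563, 1, 287031, [4963562, 4868438, 5289058]⟩, ⟨569, 1, 10372536728125, []⟩,
    ⟨571, 1, 37726019446072, []⟩, ⟨577, 1, 41714606790879, []⟩, ⟨601, 1, 106183173587, [4899088]⟩,
    ⟨613, 1, 135203676515, [4493437]⟩, ⟨641, 1, 76361364427723, []⟩,
    ⟨643, 1, 150150969, [4886087, 4902188]⟩, ⟨647, 1, 117510975593, [5273438]⟩,
    ⟨653, 1, 80270752302305, []⟩, ⟨659, 1, 74926318426, [4886697]⟩, ⟨673, 1, 103069278585140, []⟩,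
    ⟨701, 1, 42023799212, [2945337]⟩, ⟨709, 1, 47944435790649, []⟩, ⟨727, 1, 73731635046081, []⟩,
    ⟨743, 1, 386905897787, []⟩, ⟨757, 1, 198221163634, [3007817]⟩, ⟨773, 1, 75698531604829, []⟩,
    ⟨787, 1, 53082886507, [5273444]⟩, ⟨797, 1, 236806004248640, []⟩,
    ⟨823, 1, 331151032964, [2851712]⟩, ⟨827, 1, 134870536262, [3007837]⟩,
    ⟨829, 1, 447716362163, [4965337]⟩, ⟨839, 1, 561990, [4492862, 4492813, 4820962]⟩,
    ⟨853, 1, 239811509447618, []⟩, ⟨883, 1, 307867757582880, []⟩,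
    ⟨907, 1, 466420, [4976686, 4495962, 2617312]⟩, ⟨911, 1, 371164, [4886558, 4976613, 4963442]⟩,
    ⟨937, 1, 19026218567814, []⟩, ⟨953, 1, 738604633200, [4889063]⟩, ⟨991, 1, 612615440781047, []⟩,
    ⟨997, 1, 827136363, [6851563, 4976564]⟩, ⟨1009, 1, 280832432416310, []⟩,
    ⟨1031, 1, 438554135692, [4964113]⟩, ⟨1033, 1, 651431369844, [4904697]⟩]

theorem tableB_check : tableB.all check = true := by decide +kernel

def tableC : List SmoothCert :=
  [⟨1051, 1, 463249179171609, []⟩, ⟨1061, 1, 417497312, [4898488, 4920313]⟩,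
    ⟨1091, 1, 58991848453, [4805437]⟩, ⟨1093, 1, 158624, [6838962, 4885814, 4886538]⟩,
    ⟨1097, 1, 1319586878867539, []⟩, ⟨1129, 1, 1268179741114222, []⟩,
    ⟨1151, 1, 2262299, [4868447, 2945938]⟩, ⟨1181, 1, 70068761473528, []⟩,
    ⟨1193, 1, 683640720733113, []⟩, ⟨1201, 1, 4048588499263, []⟩,
    ⟨1213, 1, 1129585684, [6851588, 5054688]⟩, ⟨1217, 1, 1121622114578, [5289188]⟩,
    ⟨1229, 1, 1443503886008359, []⟩, ⟨1237, 1, 101401062289150, []⟩,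
    ⟨1277, 1, 2303977613548, [4965312]⟩, ⟨1289, 1, 2412809848640460, []⟩,
    ⟨1303, 1, 67785944, [4898589, 6835964]⟩, ⟨1307, 1, 540067222542, [5035938]⟩,
    ⟨1361, 1, 749298542407, [2945587]⟩, ⟨1367, 1, 2149482397005951, []⟩,
    ⟨1381, 1, 3784902439647466, []⟩, ⟨1399, 1, 30556326173, [3335963]⟩,
    ⟨1409, 1, 1669798780012, [6837812]⟩, ⟨1423, 1, 2313128998163235, []⟩,
    ⟨1427, 1, 3091282071220, [4957942]⟩, ⟨1433, 1, 785126, [4885939, 4887197, 2945313]⟩,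
    ⟨1439, 1, 2498344079208, [2929692]⟩, ⟨1447, 1, 4016086692830, [6839072]⟩,
    ⟨1453, 1, 6236524648505970, []⟩, ⟨1459, 1, 3584189206092, [2945362]⟩,
    ⟨1483, 1, 3796663353682545, []⟩, ⟨1487, 1, 295577066, [5270437, 4961563]⟩,
    ⟨1511, 1, 1211282, [2946562, 5276587, 4961063]⟩, ⟨1531, 1, 1142249643444039, []⟩,
    ⟨1549, 1, 641438, [2933442, 4886187, 4964064]⟩, ⟨1553, 1, 302228352375, [5357813]⟩,
    ⟨1559, 1, 3340708319227, [5351563]⟩, ⟨1579, 1, 874885938085, [4898938]⟩,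
    ⟨1601, 1, 1281869123189644, []⟩, ⟨1607, 1, 3086303105, [1055312, 4885993]⟩,
    ⟨1609, 1, 3804225293240, [2929737]⟩, ⟨1613, 1, 9209220603958770, []⟩,
    ⟨1637, 1, 1429907871393916, []⟩, ⟨1663, 1, 6913550936444, [4886238]⟩,
    ⟨1669, 1, 7477572882618, [4898428]⟩, ⟨1693, 1, 2813898721636662, []⟩,
    ⟨1697, 1, 2393258721, [4960964, 4889067]⟩, ⟨1699, 1, 2524350660565, [5274064]⟩,
    ⟨1723, 1, 1770169, [2934063, 4885982, 4960813]⟩, ⟨1733, 1, 512221464, [3086062, 6836213]⟩,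
    ⟨1741, 1, 13010725172196942, []⟩, ⟨1747, 1, 5926103553658, [5276682]⟩,
    ⟨1759, 1, 14061017138159295, []⟩, ⟨1777, 1, 1955948574313, [4492838]⟩,
    ⟨1789, 1, 4407835909751, [4945438]⟩, ⟨1823, 1, 4263590153333, [8398438]⟩,
    ⟨1831, 1, 4185471597, [6835813, 4895313]⟩, ⟨1861, 1, 10672492509086, [5277212]⟩,
    ⟨1867, 1, 4177944918, [9179688, 6917212]⟩, ⟨1871, 1, 3593753720680, [4888442]⟩]

theorem tableC_check : tableC.all check = true := by decide +kernel

def tableD : List SmoothCert :=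
  [⟨1907, 1, 12100851848356, [5367186]⟩, ⟨1933, 1, 5698313470086, [7307813]⟩,
    ⟨1949, 1, 13694428585675391, []⟩, ⟨1951, 1, 1127178, [4898560, 4964117, 5270313]⟩,
    ⟨1973, 1, 0, [4886842, 4898483, 4885962, 4886688, 4805312]⟩,
    ⟨1979, 1, 2515553, [4914066, 4898663, 4895437]⟩, ⟨1997, 1, 16510, [2930337, 2930314, 5273428]⟩,
    ⟨1999, 1, 11683066553028, [4889077]⟩, ⟨2003, 1, 1655474710917, [4961088]⟩,
    ⟨2027, 1, 5749206133114, [4102187]⟩, ⟨2039, 1, 4003400833, [4905313, 4964082]⟩,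
    ⟨2053, 1, 7778641889436150, []⟩, ⟨2063, 1, 73421994, [4905437, 4957938]⟩,
    ⟨2081, 1, 1068366299830, [4870962]⟩, ⟨2087, 1, 14681402157786, [2929839]⟩,
    ⟨2099, 1, 5763158271, [6839068, 5355312]⟩, ⟨2111, 1, 15856595302756, [4958462]⟩,
    ⟨2131, 1, 19009536883618841, []⟩, ⟨2143, 1, 20909213684665, [4871563]⟩,
    ⟨2153, 1, 4998964103, [4899688, 4914188]⟩, ⟨2161, 1, 20793334916843, [4898689]⟩,
    ⟨2213, 1, 1923835593241939, []⟩, ⟨2237, 1, 10669632213797, [6835934]⟩,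
    ⟨2239, 1, 17152154605868, [5679686]⟩, ⟨2251, 1, 837305898790, [4961085]⟩,
    ⟨2267, 1, 5502052470, [6837213, 6836563]⟩, ⟨2269, 1, 16358289174664, [4727312]⟩,
    ⟨2273, 1, 25366548710194439, []⟩, ⟨2281, 1, 11855479504332967, []⟩,
    ⟨2287, 1, 54488091914348960, []⟩, ⟨2297, 1, 14369149313379, [1370313]⟩,
    ⟨2309, 1, 27012880365664, [5039058]⟩, ⟨2333, 1, 22666234126820, [4805937]⟩,
    ⟨2339, 1, 68114927551362963, []⟩, ⟨2341, 1, 20132041401355, [6992188]⟩,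
    ⟨2351, 1, 29433334125451291, []⟩, ⟨2381, 1, 24233975652084, [4963687]⟩,
    ⟨2383, 1, 6440085636209, [4886312]⟩, ⟨2389, 1, 299360, [980312, 6995437, 6917137]⟩,
    ⟨2393, 1, 4399595273549, [4960944]⟩, ⟨2417, 1, 3447429200055, [5351689]⟩,
    ⟨2437, 1, 60894984992173347, []⟩, ⟨2441, 1, 3696334835600, [4805939]⟩,
    ⟨2447, 1, 61613206071246014, []⟩, ⟨2459, 1, 34322368899400, [2930319]⟩,
    ⟨2521, 1, 4032538538764, [4102192]⟩, ⟨2539, 1, 26039161288719, [2992192]⟩,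
    ⟨2543, 1, 103458714455630775, []⟩, ⟨2609, 1, 27317843574528566, []⟩,
    ⟨2617, 1, 82641566697338889, []⟩, ⟨2647, 1, 9404288565051, [5276713]⟩,
    ⟨2657, 1, 100591393521305140, []⟩, ⟨2677, 1, 17699614269, [5042212, 2945488]⟩,
    ⟨2683, 1, 19012199720828, [5742186]⟩, ⟨2711, 1, 5248779, [4885947, 5273469, 1370437]⟩,
    ⟨2719, 1, 67210603948192607, []⟩, ⟨2729, 1, 29862955695174, [5195338]⟩,
    ⟨2749, 1, 29708474581819, [4967837]⟩, ⟨2767, 1, 1259304, [975963, 5057813, 4964067]⟩,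
    ⟨2777, 1, 6348758847843, [5273434]⟩]

theorem tableD_check : tableD.all check = true := by decide +kernel

def tableE : List SmoothCert :=
  [⟨2803, 1, 136541972469293264, []⟩, ⟨2843, 1, 169456770032416084, []⟩,
    ⟨2857, 1, 121282933984249681, []⟩, ⟨2879, 1, 1873543, [4901714, 5042837, 2867188]⟩,
    ⟨2887, 1, 51347540567053, [2945437]⟩, ⟨2903, 1, 290144122641, [4805313]⟩,
    ⟨2909, 1, 20363719668281799, []⟩, ⟨2927, 1, 124269180040180910, []⟩,
    ⟨2953, 1, 6253722118737, [4895317]⟩, ⟨2957, 1, 126177385410503496, []⟩,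
    ⟨2963, 1, 72775550681676, [4967337]⟩, ⟨2969, 1, 8352263817, [5042322, 4961564]⟩,
    ⟨3037, 1, 10105261578, [4905312, 3321562]⟩, ⟨3041, 1, 57000533826616029, []⟩,
    ⟨3049, 1, 18389606691205861, []⟩, ⟨3067, 1, 15889906309150, [5277317]⟩,
    ⟨3079, 1, 84822950023089, [4961113]⟩, ⟨3089, 1, 1486438022, [4889692, 4885847]⟩,
    ⟨3119, 1, 44524346802150, [4889189]⟩, ⟨3181, 1, 5959959, [4967062, 5354862, 3085938]⟩,
    ⟨3187, 1, 29265555874256, [5039113]⟩, ⟨3191, 1, 3300169, [7617313, 4889092, 4105312]⟩,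
    ⟨3203, 1, 9965705855932209, []⟩, ⟨3209, 1, 20581118089, [4976558, 2930292]⟩,
    ⟨3221, 1, 73686823924791535, []⟩, ⟨3229, 1, 7757877, [4880462, 1057817, 5120437]⟩,
    ⟨3251, 1, 174924054831794399, []⟩, ⟨3257, 1, 66337439291479, [4913938]⟩,
    ⟨3259, 1, 307723229398905702, []⟩, ⟨3271, 1, 93572736360898, [4886083]⟩,
    ⟨3299, 1, 27052744068748, [4649063]⟩, ⟨3307, 1, 25271883734292, [4889162]⟩,
    ⟨3319, 1, 336463889639728447, []⟩, ⟨3323, 1, 32102079603, [5273446, 4964118]⟩,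
    ⟨3331, 1, 19456061043, [3007862, 4911562]⟩, ⟨3343, 1, 11798314082461, [5277137]⟩,
    ⟨3347, 1, 320400627423226081, []⟩, ⟨3359, 1, 119443496661516, [7226564]⟩,
    ⟨3361, 1, 39731591508823, [2936687]⟩, ⟨3371, 1, 6309298, [4992189, 5277162, 4914058]⟩,
    ⟨3391, 1, 23574272050780565, []⟩, ⟨3407, 1, 32165148458, [4886082, 4895587]⟩,
    ⟨3413, 1, 3262667, [5274188, 5277188, 4890187]⟩,
    ⟨3449, 1, 3730444, [4805438, 4887237, 4570987]⟩, ⟨3461, 1, 339677639944878400, []⟩,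
    ⟨3467, 1, 320916716093875075, []⟩, ⟨3491, 1, 420423525510212524, []⟩,
    ⟨3511, 1, 107001888058220, [6835966]⟩, ⟨3517, 1, 59349220412751, [4901569]⟩,
    ⟨3541, 1, 388127720336926566, []⟩, ⟨3547, 1, 4744670, [6835838, 4885948, 3008462]⟩,
    ⟨3557, 1, 9442128317410, [4914089]⟩, ⟨3559, 1, 469899651138862021, []⟩,
    ⟨3571, 1, 63350245976975, [4887217]⟩, ⟨3583, 1, 550559105442208461, []⟩,
    ⟨3617, 1, 21632788529, [4886568, 6839562]⟩, ⟨3643, 1, 111186494057227, [3335944]⟩,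
    ⟨3671, 1, 287512090821446110, []⟩, ⟨3673, 1, 17596865758, [4898469, 979812]⟩,
    ⟨3709, 1, 93283932325543389, []⟩]

theorem tableE_check : tableE.all check = true := by decide +kernel

def tableF : List SmoothCert :=
  [⟨3719, 1, 10754378, [6839693, 5277313, 4961688]⟩, ⟨3727, 1, 500638913443817686, []⟩,
    ⟨3761, 1, 80926150082050753, []⟩, ⟨3769, 1, 0, [4492688, 6839687, 5273464, 4886714, 4917211]⟩,
    ⟨3779, 1, 456916071546685501, []⟩, ⟨3793, 1, 171563184625127, [5276573]⟩,
    ⟨3797, 1, 14160874173, [4904818, 8789113]⟩, ⟨3833, 1, 748854911697560372, []⟩,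
    ⟨3847, 1, 214025630328372, [7242813]⟩, ⟨3851, 1, 76684024729532, [6917437]⟩,
    ⟨3853, 1, 4203544961539, [5276564]⟩, ⟨3863, 1, 93834006948498, [4967338]⟩,
    ⟨3911, 1, 55450042926, [3007939, 6836689]⟩, ⟨3919, 1, 148671038708038, [4877213]⟩,
    ⟨3923, 1, 96089591279943, [4945463]⟩, ⟨3931, 1, 554127072600640416, []⟩,
    ⟨3943, 1, 190474719323276, [4889207]⟩, ⟨3947, 1, 176860390081764, [6839061]⟩,
    ⟨4007, 1, 5144792417, [4887313, 5273439]⟩, ⟨4021, 1, 260542185757529, [4982937]⟩,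
    ⟨4049, 1, 230061543699413, [3320962]⟩, ⟨4051, 1, 221544895730035, [4808439]⟩,
    ⟨4079, 1, 514990, [4904686, 4885998, 6914064]⟩, ⟨4093, 1, 204642114827107, [5679814]⟩,
    ⟨4099, 1, 178751823923488, [4886592]⟩, ⟨4111, 1, 57891237036277474, []⟩,
    ⟨4127, 1, 652131858974877228, []⟩, ⟨4139, 1, 161241865692497, [6857942]⟩,
    ⟨4153, 1, 353201774601208858, []⟩, ⟨4157, 1, 468468848465123768, []⟩,
    ⟨4177, 1, 770471940348926523, []⟩, ⟨4201, 1, 269465100105868831, []⟩,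
    ⟨4229, 1, 40845430157, [5273561, 4895338]⟩, ⟨4253, 1, 1181006111036723064, []⟩,
    ⟨4259, 1, 12359098975682, [4571087]⟩, ⟨4271, 1, 907754130332639602, []⟩,
    ⟨4273, 1, 15312677489, [4889058, 4886092]⟩, ⟨4283, 1, 420645085520955690, []⟩,
    ⟨4297, 1, 318764355987514, [7242183]⟩, ⟨4327, 1, 56755089838114, [4889187]⟩,
    ⟨4349, 1, 574713698254409611, []⟩, ⟨4373, 1, 428724112841227904, []⟩,
    ⟨4397, 1, 5020446, [4886687, 4965442, 5276539]⟩,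
    ⟨4421, 1, 4101162, [5304689, 2926597, 4524062]⟩,
    ⟨4423, 1, 8219049, [4914713, 4967188, 5352314]⟩, ⟨4441, 1, 277443908006119, [6839087]⟩,
    ⟨4447, 1, 377251492006853, [5026688]⟩, ⟨4451, 1, 12942075105, [2929812, 6835914]⟩,
    ⟨4457, 1, 1164643377689366631, []⟩, ⟨4463, 1, 12789658653084, [4895987]⟩,
    ⟨4507, 1, 78684027110, [2960938, 3335967]⟩, ⟨4517, 1, 279250352174296, [5042193]⟩,
    ⟨4523, 1, 1802340583843013288, []⟩, ⟨4547, 1, 322248998021332, [4967317]⟩,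
    ⟨4549, 1, 1261230447603589569, []⟩, ⟨4561, 1, 689285540607159318, []⟩,
    ⟨4567, 1, 1786993220852783047, []⟩, ⟨4621, 1, 1679413945767161220, []⟩,
    ⟨4651, 1, 453912782506972102, []⟩, ⟨4657, 1, 14960767640803060, []⟩]

theorem tableF_check : tableF.all check = true := by decide +kernel

def tableG : List SmoothCert :=
  [⟨4691, 1, 1778072345802784979, []⟩, ⟨4703, 1, 42384397291244, [4805962]⟩,
    ⟨4721, 1, 97285804124608, [4886189]⟩, ⟨4723, 1, 81136745256, [3351587, 4886438]⟩,
    ⟨4759, 1, 985888804845164774, []⟩, ⟨4799, 1, 83983717717, [4886068, 4888938]⟩,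
    ⟨4817, 1, 3438848, [3335812, 4888687, 4871087]⟩, ⟨4861, 1, 109458766394, [1133437, 2914688]⟩,
    ⟨4871, 1, 269907163287932148, []⟩, ⟨4877, 1, 365410707289546, [6835946]⟩,
    ⟨4931, 1, 219768792076109, [4885817]⟩, ⟨4937, 1, 2056659736377988892, []⟩,
    ⟨4957, 1, 59838618305, [4954693, 2930435]⟩, ⟨4969, 1, 2473075498649059877, []⟩,
    ⟨4987, 1, 31486070245014, [5042242]⟩, ⟨4993, 1, 579392779433202, [5351589]⟩,
    ⟨4999, 1, 241152774617818, [5354692]⟩, ⟨5003, 1, 4418698064, [4491692, 2930362]⟩,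
    ⟨5021, 1, 54752762704, [4495937, 4898189]⟩, ⟨5023, 1, 100657515075, [3007947, 4885973]⟩,
    ⟨5051, 1, 2279538327880707604, []⟩, ⟨5059, 1, 13358190438, [4886569, 4954737]⟩,
    ⟨5077, 1, 30498411023430, [5304813]⟩, ⟨5081, 1, 263380694792145, [3321187]⟩,
    ⟨5099, 1, 21600913687, [4983437, 4524187]⟩,
    ⟨5101, 1, 0, [5682938, 4802192, 5270937, 2929827, 7245311]⟩,
    ⟨5107, 1, 1626914763649282259, []⟩, ⟨5119, 1, 598316987496756, [4961069]⟩,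
    ⟨5153, 1, 4999902470, [4886197, 2929713]⟩, ⟨5171, 1, 1494237447814411060, []⟩,
    ⟨5179, 1, 1915538167028344513, []⟩, ⟨5189, 1, 1975735266128851310, []⟩,
    ⟨5231, 1, 118337721440, [4885929, 6836188]⟩, ⟨5233, 1, 17081270, [4901313, 3007813, 2930472]⟩,
    ⟨5237, 1, 643541629541973, [7229062]⟩, ⟨5261, 1, 408126696187921, [977192]⟩,
    ⟨5273, 1, 1676325868802967384, []⟩, ⟨5279, 1, 556551395132418493, []⟩,
    ⟨5303, 1, 42403013719368392, []⟩, ⟨5323, 1, 20454089, [4889212, 4889689, 4963587]⟩,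
    ⟨5347, 1, 3312703705062609685, []⟩, ⟨5413, 1, 429397165578615, [6914069]⟩,
    ⟨5437, 1, 3183908252536872752, []⟩, ⟨5441, 1, 2124216536651846636, []⟩,
    ⟨5479, 1, 4325808405398410911, []⟩, ⟨5483, 1, 3098566884826740638, []⟩,
    ⟨5521, 1, 4419227116456083024, []⟩, ⟨5527, 1, 2605533651637580735, []⟩,
    ⟨5531, 1, 510579448856322, [4758437]⟩, ⟨5557, 1, 193232936172045333, []⟩,
    ⟨5563, 1, 501445733032760, [4867938]⟩, ⟨5573, 1, 51727666371, [4902813, 4967087]⟩,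
    ⟨5581, 1, 953492933561637, [5038938]⟩, ⟨5591, 1, 833932722842222, [5276565]⟩,
    ⟨5623, 1, 204275447450198, [5661187]⟩, ⟨5651, 1, 496161331242192, [4180317]⟩,
    ⟨5659, 1, 1137577169700286783, []⟩, ⟨5711, 1, 593811277905793, [3320437]⟩,
    ⟨5743, 1, 2860511753663324338, []⟩, ⟨5749, 1, 117487400889, [979737, 4964692]⟩]

theorem tableG_check : tableG.all check = true := by decide +kernel

def tableH : List SmoothCert :=
  [⟨5783, 1, 3509914437987762928, []⟩, ⟨5807, 1, 638343878883325557, []⟩,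
    ⟨5843, 1, 446480003444623, [4886183]⟩, ⟨5861, 1, 894407611531414, [5274814]⟩,
    ⟨5897, 1, 3296483123370601740, []⟩, ⟨5923, 1, 510167382745003468, []⟩,
    ⟨5927, 1, 6715821210741296668, []⟩, ⟨5939, 1, 1004476233619148, [4571567]⟩,
    ⟨5953, 1, 999785643669744, [3086587]⟩, ⟨5987, 1, 89523898296679, [4904711]⟩,
    ⟨6007, 1, 22589870, [4414713, 4952312, 4904712]⟩, ⟨6037, 1, 75954391271815, [6838942]⟩,
    ⟨6079, 1, 172119849010102, [8804689]⟩, ⟨6089, 1, 5708790268489275203, []⟩,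
    ⟨6121, 1, 5821399211016324853, []⟩, ⟨6131, 1, 181985627398222, [6870938]⟩,
    ⟨6143, 1, 51136070557, [7242311, 6461563]⟩, ⟨6163, 1, 113759787141, [5352813, 4904817]⟩,
    ⟨6199, 1, 6383865723383626934, []⟩, ⟨6211, 1, 231564329315, [6839312, 5355962]⟩,
    ⟨6229, 1, 1141887352149884, [5742213]⟩, ⟨6263, 1, 1464738063216461689, []⟩,
    ⟨6269, 1, 1408730068755367, [3242937]⟩, ⟨6271, 1, 1788400699901280727, []⟩,
    ⟨6277, 1, 4465685499288847535, []⟩, ⟨6301, 1, 634121591553306, [4898314]⟩,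
    ⟨6329, 1, 533516781618924, [4892212]⟩, ⟨6343, 1, 1419907204598934, [4492987]⟩,
    ⟨6353, 1, 306601413590592, [4905362]⟩, ⟨6359, 1, 72543265223579, [4805447]⟩,
    ⟨6361, 1, 8976397765895128021, []⟩, ⟨6367, 1, 651807336803527, [6807937]⟩,
    ⟨6373, 1, 567234291368197, [4992239]⟩, ⟨6379, 1, 1186593020179545, [5382838]⟩,
    ⟨6389, 1, 10284547805397989497, []⟩, ⟨6397, 1, 3686749, [4898438, 5276537, 4887243]⟩,
    ⟨6427, 1, 77221545183, [5274114, 3321437]⟩]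

theorem tableH_check : tableH.all check = true := by decide +kernel

/-- The certificates for all prime powers up to `6463` that may be norms of primes, but `4`, `8`. -/
def table : List SmoothCert :=
  tableA ++ tableB ++ tableC ++ tableD ++ tableE ++ tableF ++ tableG ++ tableH

/-- The integer `-151` is not a square in a field of odd cardinality `q` and characteristic `p`. -/
def nonresidue (p q : ℕ) : Bool :=
  q % 2 == 1 && 151 * (p - 1) % p != 0 && (151 * (p - 1)) ^ (q / 2) % p != 1

def covered (p f : ℕ) : Bool :=
  nonresidue p (p ^ f) || table.any (fun t => Nat.beq t.p p && Nat.beq t.f f)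

def smallPrimes : List ℕ :=
  [2, 3, 5, 7, 11, 13, 17, 19, 23, 29, 31, 37, 41, 43, 47, 53, 59, 61, 67, 71, 73, 79]

theorem covered_one :
    (List.range 6464).all (fun n =>
      Nat.ble n 1 || smallPrimes.any (fun d => Nat.beq (n % d) 0 && !Nat.beq n d) ||
        covered n 1) = true := by
  decide +kernel

theorem covered_of_two_le :
    smallPrimes.all (fun p => (List.range 13).all (fun f =>
      Nat.ble f 1 || Nat.ble 6464 (p ^ f) || Nat.beq (p ^ f) 4 || Nat.beq (p ^ f) 8 ||
        covered p f)) = true := by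
  decide +kernel

end SmoothCert

namespace Quint

/-- The value at `t` of a coefficient vector. -/
def eval {α R : Type*} [CommSemiring α] [CommRing R] (f : α →+* R) (t : R) (x : Quint α) : R :=
  f x.c₀ + f x.c₁ * t + f x.c₂ * t ^ 2 + f x.c₃ * t ^ 3 + f x.c₄ * t ^ 4

section eval

variable {α R : Type*} [CommSemiring α] [CommRing R] (f : α →+* R) {t : R}

theorem eval_mul (ht : t ^ 5 = t + 1) (x y : Quint α) :
    eval f t (x.mul y) = eval f t x * eval f t y := by
  simp only [eval, mul, map_add, map_mul]
  linear_combination (-(f x.c₁ * f y.c₄ + f x.c₂ * f y.c₃ + f x.c₃ * f y.c₂ + f x.c₄ * f y.c₁) -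
    (f x.c₂ * f y.c₄ + f x.c₃ * f y.c₃ + f x.c₄ * f y.c₂) * t -
    (f x.c₃ * f y.c₄ + f x.c₄ * f y.c₃) * t ^ 2 - f x.c₄ * f y.c₄ * t ^ 3) * ht

theorem eval_add (x y : Quint α) : eval f t (x.add y) = eval f t x + eval f t y := by
  simp only [eval, add, map_add]
  ring

theorem eval_shift (ht : t ^ 5 = t + 1) (x : Quint α) : eval f t x.shift = t * eval f t x := by
  simp only [eval, shift, map_add]
  linear_combination -f x.c₄ * ht

theorem eval_mk (a b c d e : α) :
    eval f t ⟨a, b, c, d, e⟩ = f a + f b * t + f c * t ^ 2 + f d * t ^ 3 + f e * t ^ 4 := rfl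

theorem map_eval {S : Type*} [CommRing S] (g : R →+* S) (x : Quint α) :
    g (eval f t x) = eval (g.comp f) (g t) x := by
  simp [eval]

end eval

section residues

variable {R : Type*} [CommRing R] {p : ℕ} {t : R}

theorem natCast_mod_of_eq_zero (hp : (p : R) = 0) (n : ℕ) : ((n % p : ℕ) : R) = n := by
  conv_rhs => rw [← Nat.mod_add_div n p]
  simp [hp]

theorem natCast_toNat_emod (h₀ : 0 < p) (hp : (p : R) = 0) (n : ℤ) :
    (((n % p).toNat : ℕ) : R) = n := by
  have h : (((n % p).toNat : ℕ) : ℤ) = n % p :=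
    Int.toNat_of_nonneg (Int.emod_nonneg _ (by exact_mod_cast h₀.ne'))
  have h' : (((n % p).toNat : ℕ) : R) = ((n % p : ℤ) : R) := by
    simpa only [Int.cast_natCast] using congrArg (Int.cast : ℤ → R) h
  rw [h']
  conv_rhs => rw [← Int.emod_add_mul_ediv n p]
  simp [hp]

theorem eval_red (hp : (p : R) = 0) (x : Quint ℕ) :
    eval (Nat.castRingHom R) t (x.red p) = eval (Nat.castRingHom R) t x := by
  simp [eval, red, natCast_mod_of_eq_zero hp]

theorem eval_redInt (h₀ : 0 < p) (hp : (p : R) = 0) (x : Quint ℤ) :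
    eval (Nat.castRingHom R) t (x.redInt p) = eval (Int.castRingHom R) t x := by
  simp only [eval, redInt, Nat.coe_castRingHom, Int.coe_castRingHom, natCast_toNat_emod h₀ hp]

theorem eval_powX (ht : t ^ 5 = t + 1) (hp : (p : R) = 0) (i e : ℕ) (he : e < 2 ^ i) :
    eval (Nat.castRingHom R) t (powX p i e) = t ^ e := by
  induction i generalizing e with
  | zero => simp [powX, eval, show e = 0 by simpa using he]
  | succ i ih =>
    have h := ih (e / 2) (by omega)
    rcases Nat.mod_two_eq_zero_or_one e with h₂ | h₂
    · simp only [powX, h₂, cond_false, show ((0 : ℕ) == 1) = false from rfl, eval_red hp,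
        eval_mul _ ht, h]
      rw [← pow_add]
      congr 1
      omega
    · simp only [powX, h₂, cond_true, beq_self_eq_true, eval_shift _ ht, eval_red hp,
        eval_mul _ ht, h]
      rw [← pow_add, ← pow_succ']
      congr 1
      omega

end residues

end Quint

section relNorm

variable {R : Type*} [CommRing R] {t h : R}

theorem eval_relNorm (ht : t ^ 5 = t + 1)
    (hh : h ^ 2 = (1 - t ^ 2 - t ^ 3 + t ^ 4) * h - (1 - t + t ^ 2 + 4 * t ^ 3 - 2 * t ^ 4))
    (x y : Quint ℤ) :
    (relNorm x y).eval (Int.castRingHom R) t =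
      (x.eval (Int.castRingHom R) t + y.eval (Int.castRingHom R) t * h) *
        (x.eval (Int.castRingHom R) t +
          y.eval (Int.castRingHom R) t * (1 - t ^ 2 - t ^ 3 + t ^ 4 - h)) := by
  simp only [relNorm, Quint.eval_add, Quint.eval_mul _ ht, Quint.eval_mk, Int.coe_castRingHom]
  push_cast
  linear_combination (y.eval (Int.castRingHom R) t) ^ 2 * hh

end relNorm

namespace SmoothCert

theorem smoothNorm_spec {q N : ℕ} (h : smoothNorm q N = true) (hq : q ∣ N) :
    ∃ a b, N / q = a * b ∧ 1 ≤ N / q ∧ a.Coprime b ∧ a < q ∧ b < q := by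
  have h₀ : N % q = 0 := Nat.mod_eq_zero_of_dvd hq
  simp only [smoothNorm, h₀, bne_self_eq_false, Bool.false_or, Bool.and_eq_true, Nat.ble_eq,
    Nat.beq_eq, Nat.blt_eq] at h
  obtain ⟨⟨⟨⟨h₁, h₂⟩, h₃⟩, h₄⟩, h₅⟩ := h
  exact ⟨_, _, h₂.symm, h₁, h₃, h₄, h₅⟩

theorem eq_of_beq {x y : Quint ℕ} (h : beq x y = true) : x = y := by
  simp only [beq, Bool.and_eq_true, Nat.beq_eq] at h
  obtain ⟨⟨⟨⟨h₁, h₂⟩, h₃⟩, h₄⟩, h₅⟩ := h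
  ext <;> assumption

variable {R : Type*} [CommRing R] {t : R}

theorem eval_prodNorms {p : ℕ} (ht : t ^ 5 = t + 1) (h₀ : 0 < p) (hp : (p : R) = 0)
    (l : List ℕ) : (prodNorms p l).eval (Nat.castRingHom R) t =
      (l.map fun c => (codeNorm c).eval (Int.castRingHom R) t).prod := by
  induction l with
  | nil => simp [prodNorms, Quint.eval]
  | cons c l ih =>
    simp [prodNorms, Quint.eval_red hp, Quint.eval_mul _ ht, Quint.eval_redInt h₀ hp, ih, mul_comm]

/-- If `t ^ p ^ f = t` in a domain of characteristic `p`, then one of the elements given by a valid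
certificate has vanishing relative norm, and its norm is smooth. -/
theorem exists_code_of_check [IsDomain R] (T : SmoothCert) (h : T.check = true)
    (ht : t ^ 5 = t + 1) (hp : (T.p : R) = 0) (hf : t ^ T.p ^ T.f = t) :
    ∃ c, (codeNorm c).eval (Int.castRingHom R) t = 0 ∧
      smoothNorm (T.p ^ T.f) (codeNorm c).norm.natAbs = true := by
  simp only [check, Bool.and_eq_true, Nat.blt_eq, List.all_eq_true] at h
  obtain ⟨⟨⟨h₀, hq⟩, hs⟩, he⟩ := h
  have hev := congrArg (Quint.eval (Nat.castRingHom R) t) (eq_of_beq he)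
  have hsub : ((T.p - 1 : ℕ) : R) = -1 := by
    rw [Nat.cast_sub h₀, hp]; simp
  have hfrob : (frobSub T.p (T.p ^ T.f)).eval (Nat.castRingHom R) t = 0 := by
    rw [frobSub, Quint.eval_add, Quint.eval_powX ht hp _ _ (by simpa using hq), Quint.eval_mk, hf]
    simp [hsub]
  rw [Quint.eval_red hp, Quint.eval_mul _ ht, hfrob, mul_zero, Quint.eval_red hp,
    eval_prodNorms ht h₀ hp, eq_comm, List.prod_eq_zero_iff, List.mem_map] at hev
  obtain ⟨c, hc, hc₀⟩ := hev
  exact ⟨c, hc₀, hs c hc⟩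

theorem table_check (T : SmoothCert) (hT : T ∈ table) : T.check = true := by
  simp only [table, List.mem_append] at hT
  rcases hT with ((((((h | h) | h) | h) | h) | h) | h) | h
  · exact List.all_eq_true.1 tableA_check T h
  · exact List.all_eq_true.1 tableB_check T h
  · exact List.all_eq_true.1 tableC_check T h
  · exact List.all_eq_true.1 tableD_check T h
  · exact List.all_eq_true.1 tableE_check T h
  · exact List.all_eq_true.1 tableF_check T h
  · exact List.all_eq_true.1 tableG_check T h
  · exact List.all_eq_true.1 tableH_check T h

/-- In a finite field of cardinality `q = p ^ f` where `-151` is a square, a root `t` of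
`X⁵ - X - 1` is a root of the relative norm of an element with smooth norm. -/
theorem exists_code_of_covered {k : Type*} [Field k] [Finite k] {t z : k} {p f : ℕ}
    (h : covered p f = true) (hp₀ : p.Prime) [CharP k p] (hk : Nat.card k = p ^ f)
    (ht : t ^ 5 = t + 1) (hz : z ^ 2 = -151) :
    ∃ c, (codeNorm c).eval (Int.castRingHom k) t = 0 ∧
      smoothNorm (p ^ f) (codeNorm c).norm.natAbs = true := by
  have := Fintype.ofFinite k
  have hp : (p : k) = 0 := CharP.cast_eq_zero k p
  have hpow (x : k) : x ^ p ^ f = x := by rw [← hk, Nat.card_eq_fintype_card, FiniteField.pow_card]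
  simp only [covered, Bool.or_eq_true, List.any_eq_true, Bool.and_eq_true, Nat.beq_eq] at h
  rcases h with h | ⟨T, hT, rfl, rfl⟩
  · exfalso
    simp only [nonresidue, Bool.and_eq_true, beq_iff_eq, bne_iff_ne] at h
    obtain ⟨⟨h₁, h₂⟩, h₃⟩ := h
    have hsub : ((151 * (p - 1) : ℕ) : k) = -151 := by
      push_cast [Nat.cast_sub (hp₀.one_le)]
      simp
    have hcast (a b : ℕ) (hab : (a : k) = b) : a ≡ b [MOD p] :=
      (CharP.natCast_eq_natCast k p).1 hab
    have hz₀ : z ≠ 0 := by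
      rintro rfl
      refine h₂ (Nat.mod_eq_zero_of_dvd ((Nat.modEq_zero_iff_dvd).1 (hcast _ 0 ?_)))
      rw [hsub, ← hz]; simp
    have hq : 2 * (p ^ f / 2) + 1 = p ^ f := by omega
    have hz₁ : z ^ (2 * (p ^ f / 2)) = 1 := by
      have h₄ := hpow z
      rw [← hq, pow_succ] at h₄
      exact mul_right_cancel₀ hz₀ (h₄.trans (one_mul z).symm)
    have h₅ := hcast ((151 * (p - 1)) ^ (p ^ f / 2)) 1 (by
      rw [Nat.cast_pow, hsub, ← hz, ← pow_mul, hz₁, Nat.cast_one])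
    rw [Nat.ModEq, Nat.mod_eq_of_lt hp₀.one_lt] at h₅
    exact h₃ h₅
  · exact exists_code_of_check T (table_check T hT) ht hp (hpow t)

end SmoothCert

section norm

open Module

theorem Quint.norm_eval {K : Type*} [Field K] [CharZero K] (b : Basis (Fin 5) ℚ K) {t : K}
    (hb : ∀ i, b i = t ^ (i : ℕ)) (ht : t ^ 5 = t + 1) (x : Quint ℤ) :
    Algebra.norm ℚ (x.eval (Int.castRingHom K) t) = x.norm := by
  obtain ⟨a₀, a₁, a₂, a₃, a₄⟩ := x
  have hM : Algebra.leftMulMatrix b (Quint.eval (Int.castRingHom K) t ⟨a₀, a₁, a₂, a₃, a₄⟩) =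
      (!![a₀, a₄, a₃, a₂, a₁; a₁, a₀ + a₄, a₄ + a₃, a₃ + a₂, a₂ + a₁;
        a₂, a₁, a₀ + a₄, a₄ + a₃, a₃ + a₂; a₃, a₂, a₁, a₀ + a₄, a₄ + a₃;
        a₄, a₃, a₂, a₁, a₀ + a₄] : Matrix (Fin 5) (Fin 5) ℤ).map (Int.castRingHom ℚ) := by
    ext i j
    rw [Algebra.leftMulMatrix_eq_repr_mul]
    have key (v : Fin 5 → ℚ) (y : K) (hy : y = ∑ i, v i • b i) (i : Fin 5) :
        b.repr y i = v i := by
      rw [hy, b.repr_sum_self]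
    refine key (fun i => (!![a₀, a₄, a₃, a₂, a₁; a₁, a₀ + a₄, a₄ + a₃, a₃ + a₂, a₂ + a₁;
        a₂, a₁, a₀ + a₄, a₄ + a₃, a₃ + a₂; a₃, a₂, a₁, a₀ + a₄, a₄ + a₃;
        a₄, a₃, a₂, a₁, a₀ + a₄] : Matrix (Fin 5) (Fin 5) ℤ).map (Int.castRingHom ℚ) i j) _ ?_ i
    fin_cases j <;>
    simp [Fin.sum_univ_five, hb, Quint.eval, Algebra.smul_def, -eq_intCast]
    · linear_combination a₄ * ht
    · linear_combination (a₄ * t + a₃) * ht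
    · linear_combination (a₄ * t ^ 2 + a₃ * t + a₂) * ht
    · linear_combination (a₄ * t ^ 3 + a₃ * t ^ 2 + a₂ * t + a₁) * ht
  rw [Algebra.norm_eq_matrix_det b, hM, ← RingHom.mapMatrix_apply, ← RingHom.map_det]
  simp only [eq_intCast, Int.cast_inj]
  simp [Matrix.det_succ_row_zero, Fin.sum_univ_succ, Quint.norm, Fin.succAbove]
  ring

theorem exists_basis_eq_pair {K L : Type*} [Field K] [Field L] [Algebra K L]
    (hL : finrank K L = 2) {h : L} (hK : h ∉ (algebraMap K L).range) :
    ∃ b : Basis (Fin 2) K L, ⇑b = ![1, h] := by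
  have hli : LinearIndependent K ![1, h] := by
    refine LinearIndependent.pair_iff.2 fun u v huv => ?_
    have hv : v = 0 := by
      by_contra hv
      refine hK ⟨-u / v, ?_⟩
      have : algebraMap K L v ≠ 0 := by simpa using hv
      simp only [Algebra.smul_def, mul_one] at huv
      rw [map_div₀, map_neg]
      field_simp
      linear_combination -huv
    subst hv
    simpa [Algebra.smul_def] using huv
  exact ⟨basisOfLinearIndependentOfCardEqFinrank hli (by simp [hL]),
    coe_basisOfLinearIndependentOfCardEqFinrank _ _⟩

theorem norm_add_mul_of_sq_eq {K L : Type*} [Field K] [Field L] [Algebra K L]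
    (hL : finrank K L = 2) {h : L} (hK : h ∉ (algebraMap K L).range) {s n : K}
    (hh : h ^ 2 = algebraMap K L s * h - algebraMap K L n) (x y : K) :
    Algebra.norm K (algebraMap K L x + algebraMap K L y * h) = x ^ 2 + s * x * y + n * y ^ 2 := by
  obtain ⟨b, hb⟩ := exists_basis_eq_pair hL hK
  have hM : Algebra.leftMulMatrix b (algebraMap K L x + algebraMap K L y * h) =
      !![x, -(n * y); y, x + s * y] := by
    ext i j
    rw [Algebra.leftMulMatrix_eq_repr_mul]
    have key (v : Fin 2 → K) (z : L) (hz : z = ∑ i, v i • b i) (i : Fin 2) :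
        b.repr z i = v i := by
      rw [hz, b.repr_sum_self]
    refine key (fun i => !![x, -(n * y); y, x + s * y] i j) _ ?_ i
    fin_cases j
    · simp [hb, Algebra.smul_def]
    · simp [hb, Algebra.smul_def]
      linear_combination algebraMap K L y * hh
  rw [Algebra.norm_eq_matrix_det b, hM, Matrix.det_fin_two_of]
  ring

end norm

section fields

open Module NumberField

theorem absNorm_span_singleton_eq_natAbs {K : Type*} [Field K] [NumberField K] {x : 𝓞 K} {N : ℤ}
    (h : Algebra.norm ℚ (algebraMap (𝓞 K) K x) = N) :
    Ideal.absNorm (Ideal.span {x}) = N.natAbs := by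
  have h' : ((Algebra.norm ℤ x : ℤ) : ℚ) = N := (Algebra.coe_norm_int x).trans h
  rw [Ideal.absNorm_span_singleton, Int.cast_inj.1 h']

theorem exists_basis_of_algEquiv {K : Type*} [Field K] [NumberField K]
    (e : K ≃ₐ[ℚ] AdjoinRoot (X ^ 5 - X - 1 : ℚ[X])) :
    ∃ (t : K) (b : Basis (Fin 5) ℚ K), t ^ 5 = t + 1 ∧ ∀ i, b i = t ^ (i : ℕ) := by
  have hd : (X ^ 5 - X - 1 : ℚ[X]).natDegree = 5 := by compute_degree!
  have h₀ : (X ^ 5 - X - 1 : ℚ[X]) ≠ 0 := fun h => by simp [h] at hd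
  have hroot : AdjoinRoot.root (X ^ 5 - X - 1 : ℚ[X]) ^ 5 =
      AdjoinRoot.root (X ^ 5 - X - 1 : ℚ[X]) + 1 := by
    have := AdjoinRoot.eval₂_root (X ^ 5 - X - 1 : ℚ[X])
    simp only [eval₂_sub, eval₂_pow, eval₂_X, eval₂_one] at this
    linear_combination this
  let pb := (AdjoinRoot.powerBasis h₀).map e.symm
  have hdim : pb.dim = 5 := by simp [pb, hd]
  refine ⟨pb.gen, pb.basis.reindex (finCongr hdim), ?_, fun i => ?_⟩
  · simp [pb, ← map_pow, hroot]
  · simp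

theorem exists_sq_eq_of_algEquiv {K L : Type*} [Field K] [NumberField K] [Field L] [Algebra K L]
    (e : L ≃ₐ[K] AdjoinRoot (X ^ 2 + 151 : K[X])) :
    finrank K L = 2 ∧ ∃ r : L, r ^ 2 = -151 ∧ r ∉ (algebraMap K L).range := by
  have hd : (X ^ 2 + 151 : K[X]).natDegree = 2 := by compute_degree!
  have h₀ : (X ^ 2 + 151 : K[X]) ≠ 0 := fun h => by simp [h] at hd
  refine ⟨?_, e.symm (AdjoinRoot.root _), ?_, ?_⟩
  · rw [e.toLinearEquiv.finrank_eq, (AdjoinRoot.powerBasis h₀).finrank, AdjoinRoot.powerBasis_dim,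
      hd]
  · have := AdjoinRoot.eval₂_root (X ^ 2 + 151 : K[X])
    simp only [eval₂_add, eval₂_pow, eval₂_X, eval₂_ofNat] at this
    rw [← map_pow, show AdjoinRoot.root (X ^ 2 + 151 : K[X]) ^ 2 = -151 by linear_combination this,
      map_neg, map_ofNat]
  · rintro ⟨x, hx⟩
    have h₁ : AdjoinRoot.mk (X ^ 2 + 151 : K[X]) (X - C x) = 0 := by
      have := congrArg e hx
      simp only [AlgEquiv.commutes, AlgEquiv.apply_symm_apply] at this
      rw [map_sub, AdjoinRoot.mk_X, AdjoinRoot.mk_C, ← this, AdjoinRoot.algebraMap_eq, sub_self]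
    have h₂ := natDegree_le_of_dvd (AdjoinRoot.mk_eq_zero.1 h₁) (X_sub_C_ne_zero x)
    rw [hd, natDegree_X_sub_C] at h₂
    omega

theorem natAbs_discr_le_of_quintic {K : Type*} [Field K] [NumberField K] {t : K}
    (b : Basis (Fin 5) ℚ K) (hb : ∀ i, b i = t ^ (i : ℕ)) (ht : t ^ 5 = t + 1) :
    (discr K).natAbs ≤ 2869 := by
  have hfin : finrank ℚ K = 5 := by simp [finrank_eq_card_basis b]
  have hd : (X ^ 5 - X - 1 : ℤ[X]).natDegree = 5 := by compute_degree!
  have hm : (X ^ 5 - X - 1 : ℤ[X]).Monic := by monicity!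
  have hmap : (X ^ 5 - X - 1 : ℤ[X]).map (algebraMap ℤ ℚ) = X ^ 5 - X - 1 := by simp
  have hmin : minpoly ℚ t = X ^ 5 - X - 1 := by
    refine (minpoly.eq_of_irreducible_of_monic
      (X_pow_sub_X_sub_one_irreducible_rat (by norm_num)) ?_ ?_).symm
    · simp [ht]
    · rw [← hmap]; exact hm.map _
  have h_int : IsIntegral ℤ t := ⟨_, hm, by simp [ht]⟩
  obtain ⟨T, hT⟩ : ∃ T : 𝓞 K, algebraMap (𝓞 K) K T = t := ⟨⟨t, h_int⟩, rfl⟩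
  have hminT : minpoly ℤ T = X ^ 5 - X - 1 := by
    refine map_injective (algebraMap ℤ ℚ) (algebraMap ℤ ℚ).injective_int ?_
    rw [hmap, ← hmin, ← hT]
    exact (minpoly.isIntegrallyClosed_eq_field_fractions ℚ K T.isIntegral).symm
  have htop : Algebra.adjoin ℚ {algebraMap (𝓞 K) K T} = ⊤ := by
    have h₁ := (Field.primitive_element_iff_minpoly_natDegree_eq ℚ t).2 (by
      rw [hmin, hfin]; compute_degree!)
    rw [← IntermediateField.adjoin_simple_toSubalgebra_of_isAlgebraic
      (Algebra.IsAlgebraic.isAlgebraic _), hT, h₁]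
    rfl
  have hmem := aeval_derivative_mem_differentIdeal ℤ ℚ K T htop
  rw [← absNorm_differentIdeal K (𝓞 K)]
  have hdvd := Ideal.absNorm_dvd_absNorm_of_le ((Ideal.span_singleton_le_iff_mem _).2 hmem)
  refine Nat.le_of_dvd (by norm_num) (hdvd.trans (dvd_of_eq ?_))
  have h₂ : algebraMap (𝓞 K) K (aeval T (derivative (minpoly ℤ T))) =
      Quint.eval (Int.castRingHom K) t ⟨-1, 0, 0, 0, 5⟩ := by
    have h₃ : aeval T (derivative (X ^ 5 - X - 1 : ℤ[X])) = 5 * T ^ 4 - 1 := by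
      simp only [derivative_X_pow, derivative_X, derivative_one, map_sub, map_mul, map_pow,
        aeval_X, map_one, aeval_C]
      simp
    rw [hminT, h₃, map_sub, map_mul, map_pow, hT, map_one, map_ofNat (algebraMap (𝓞 K) K) 5]
    simp [Quint.eval]
    ring
  rw [absNorm_span_singleton_eq_natAbs (by rw [h₂, Quint.norm_eval b hb ht])]
  rfl

end fields

section quadratic

open Module NumberField

theorem isTotallyComplex_of_sq_eq {L : Type*} [Field L] {r : L} (hr : r ^ 2 = -151) :
    IsTotallyComplex L := by
  refine ⟨fun v => InfinitePlace.not_isReal_iff_isComplex.1 fun ⟨φ, hφ, _⟩ => ?_⟩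
  have h := congrArg hφ.embedding hr
  rw [map_pow, map_neg, map_ofNat] at h
  nlinarith [sq_nonneg (hφ.embedding r)]

/-- The norm from `ℚ(√-151)` of an integer of `L` does not have norm `32`. -/
theorem natAbs_norm_ne_of_sq_eq {L : Type*} [Field L] [NumberField L] {r : L} (hr : r ^ 2 = -151)
    (x : 𝓞 L) : (Algebra.norm ℤ x).natAbs ≠ 32 := by
  intro hx
  let F := IntermediateField.adjoin ℚ {r}
  let r' : F := IntermediateField.AdjoinSimple.gen ℚ r
  have hr' : r' ^ 2 = -151 := Subtype.ext hr
  have h_int : IsIntegral ℚ r := Algebra.IsIntegral.isIntegral r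
  have hnot : r' ∉ (algebraMap ℚ F).range := by
    rintro ⟨q, hq⟩
    have h : q ^ 2 = -151 := (algebraMap ℚ F).injective (by rw [map_pow, hq, hr']; simp)
    nlinarith [sq_nonneg q]
  have hF : finrank ℚ F = 2 := by
    have h₁ : minpoly ℚ r ∣ X ^ 2 + C 151 := minpoly.dvd _ _ (by simp [hr])
    have hd : (X ^ 2 + C 151 : ℚ[X]).natDegree = 2 := natDegree_X_pow_add_C
    have h₂ := natDegree_le_of_dvd h₁ (fun h => by simp [h] at hd)
    have h₃ := (minpoly.two_le_natDegree_iff h_int).2 (by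
      rintro ⟨q, hq⟩
      exact hnot ⟨q, Subtype.ext hq⟩)
    rw [IntermediateField.adjoin.finrank h_int]
    omega
  have hnorm (u v : ℚ) : Algebra.norm ℚ (algebraMap ℚ F u + algebraMap ℚ F v * r') =
      u ^ 2 + 151 * v ^ 2 := by
    rw [norm_add_mul_of_sq_eq hF hnot (s := 0) (n := 151) (by rw [hr']; simp)]
    ring
  have hspan : ∀ z : F, ∃ u v : ℚ, z = algebraMap ℚ F u + algebraMap ℚ F v * r' := by
    obtain ⟨b, hb⟩ := exists_basis_eq_pair hF hnot
    intro z
    refine ⟨b.repr z 0, b.repr z 1, ?_⟩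
    conv_lhs => rw [← b.sum_repr z]
    simp [Fin.sum_univ_two, hb, Algebra.smul_def]
  have hZ (z : F) (hz : IsIntegral ℤ z) : ∃ m : ℤ, Algebra.norm ℚ z = m := by
    obtain ⟨m, hm⟩ := IsIntegrallyClosed.isIntegral_iff.1 (Algebra.isIntegral_norm ℚ hz)
    exact ⟨m, hm.symm⟩
  let z : F := Algebra.norm F (x : L)
  have hz : IsIntegral ℤ z := Algebra.isIntegral_norm F x.isIntegral_coe
  obtain ⟨u, v, huv⟩ := hspan z
  have h₁ : u ^ 2 + 151 * v ^ 2 = 32 := by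
    have h₂ : Algebra.norm ℚ z = Algebra.norm ℤ x := by
      rw [Algebra.norm_norm, Algebra.coe_norm_int]
    rw [huv, hnorm] at h₂
    have h₃ : (0 : ℚ) ≤ (Algebra.norm ℤ x : ℤ) := by rw [← h₂]; positivity
    rw [h₂, ← Int.natAbs_of_nonneg (Int.cast_nonneg_iff.1 h₃), hx]
    norm_num
  obtain ⟨m, hm⟩ := hZ (z + 1) (hz.add isIntegral_one)
  have h₂ : (u + 1) ^ 2 + 151 * v ^ 2 = m := by
    rw [← hm, huv, ← hnorm, map_add (algebraMap ℚ F), map_one (algebraMap ℚ F)]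
    congr 1
    ring
  obtain ⟨T, hT⟩ : ∃ T : ℤ, 2 * u = T := ⟨m - 33, by push_cast; linarith⟩
  have h₃ : (302 * v) ^ 2 = (151 * (128 - T ^ 2) : ℤ) := by
    push_cast
    rw [← hT]
    linear_combination 4 * 151 * h₁
  obtain ⟨w, hw⟩ := IsIntegrallyClosed.exists_algebraMap_eq_of_isIntegral_pow (R := ℤ)
    (x := 302 * v) (n := 2) two_pos (by rw [h₃]; exact isIntegral_algebraMap)
  have h₄ : w ^ 2 = 151 * (128 - T ^ 2) := by
    rw [← hw, eq_intCast] at h₃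
    exact_mod_cast h₃
  obtain ⟨w', rfl⟩ : (151 : ℤ) ∣ w :=
    Int.Prime.dvd_pow' (p := 151) (by norm_num) (Dvd.intro _ h₄.symm)
  have h₅ : 151 * w' ^ 2 = 128 - T ^ 2 := by linarith
  have hw0 : w' = 0 := by
    have : w' ^ 2 < 1 := by nlinarith [sq_nonneg T]
    exact pow_eq_zero_iff two_ne_zero |>.1 (le_antisymm (by omega) (sq_nonneg _))
  have h₆ : T ^ 2 = 128 := by rw [hw0] at h₅; linarith
  have : T ≤ 12 := by nlinarith
  have : -12 ≤ T := by nlinarith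
  interval_cases T <;> omega

end quadratic

section fields

open Module NumberField

open Real nonZeroDivisors in
theorem exists_mk0_eq_of_discr_le {L : Type*} [Field L] [NumberField L] [IsTotallyComplex L]
    (hd : (discr L).natAbs ≤ 151 ^ 3 * 2869 ^ 2) (hL : finrank ℚ L = 10)
    (c : ClassGroup (𝓞 L)) :
    ∃ I : (Ideal (𝓞 L))⁰, ClassGroup.mk0 I = c ∧ Ideal.absNorm (I : Ideal (𝓞 L)) ≤ 6464 := by
  obtain ⟨I, hI, hle⟩ := exists_ideal_in_class_of_norm_le c
  refine ⟨I, hI, ?_⟩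
  have hr : InfinitePlace.nrComplexPlaces L = 5 := by
    have := IsTotallyComplex.finrank L
    omega
  rw [hr, hL] at hle
  have hd' : |(discr L : ℝ)| ≤ 151 ^ 3 * 2869 ^ 2 := by
    rw [← Int.cast_abs, Int.abs_eq_natAbs]
    exact_mod_cast hd
  have hs : √|(discr L : ℝ)| ≤ 5323485 := by
    rw [Real.sqrt_le_left (by norm_num)]
    exact hd'.trans (by norm_num)
  have hπ : (4 / π) ^ 5 ≤ (4 / 3.141592) ^ 5 := by
    gcongr
    exact pi_gt_d6.le
  have hlt : (Ideal.absNorm (I : Ideal (𝓞 L)) : ℝ) < 6465 := by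
    refine hle.trans_lt ?_
    calc _ ≤ (4 / 3.141592) ^ 5 * (((10).factorial : ℝ) / (10 : ℕ) ^ 10 * 5323485) := by gcongr
      _ < 6465 := by norm_num [Nat.factorial]
  have : Ideal.absNorm (I : Ideal (𝓞 L)) < 6465 := by exact_mod_cast hlt
  omega

open nonZeroDivisors in
theorem exists_generators {K L : Type*} [Field K] [NumberField K]
    [Field L] [NumberField L] [Algebra K L]
    (eK : K ≃ₐ[ℚ] AdjoinRoot (X ^ 5 - X - 1 : ℚ[X]))
    (eL : L ≃ₐ[K] AdjoinRoot (X ^ 2 + 151 : K[X])) :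
    ∃ t h : 𝓞 L, t ^ 5 = t + 1 ∧
      h ^ 2 = (1 - t ^ 2 - t ^ 3 + t ^ 4) * h - (1 - t + t ^ 2 + 4 * t ^ 3 - 2 * t ^ 4) ∧
      (∀ x y : Quint ℤ, Ideal.absNorm (Ideal.span {x.eval (Int.castRingHom (𝓞 L)) t +
        y.eval (Int.castRingHom (𝓞 L)) t * h}) = (relNorm x y).norm.natAbs) ∧
      (∀ x : 𝓞 L, Ideal.absNorm (Ideal.span {x}) ≠ 32) ∧
      ∀ c, ∃ I : (Ideal (𝓞 L))⁰, ClassGroup.mk0 I = c ∧ Ideal.absNorm (I : Ideal (𝓞 L)) ≤ 6464 := by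
  obtain ⟨t, b, ht, hb⟩ := exists_basis_of_algEquiv eK
  obtain ⟨hL, r, hr, hrK⟩ := exists_sq_eq_of_algEquiv eL
  have hK : finrank ℚ K = 5 := by simp [finrank_eq_card_basis b]
  let s : K := 1 - t ^ 2 - t ^ 3 + t ^ 4
  let n : K := 1 - t + t ^ 2 + 4 * t ^ 3 - 2 * t ^ 4
  let κ : K := 31 - 24 * t - 11 * t ^ 2 + 39 * t ^ 3 - t ^ 4
  have hκ : κ * (2 + 2 * t ^ 2 - t ^ 3) = 151 := by
    simp only [κ]
    linear_combination (89 - 41 * t + t ^ 2) * ht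
  have hκ₂ : 151 * (s ^ 2 - 4 * n) = - κ ^ 2 := by
    simp only [κ, s, n]
    linear_combination (-508 + 1392 * t - 380 * t ^ 2 + 152 * t ^ 3) * ht
  let h : L := (algebraMap K L s + r * algebraMap K L κ / 151) / 2
  have hh : h ^ 2 = algebraMap K L s * h - algebraMap K L n := by
    have := congrArg (algebraMap K L) hκ₂
    simp only [map_sub, map_pow, map_mul, map_ofNat, map_neg] at this
    simp only [h]
    field_simp
    linear_combination algebraMap K L κ ^ 2 * hr - 151 * this
  have hhK : h ∉ (algebraMap K L).range := by
    rintro ⟨x, hx⟩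
    have hκ0 : κ ≠ 0 := fun h0 => by rw [h0, zero_mul] at hκ; norm_num at hκ
    refine hrK ⟨(2 * x - s) * 151 / κ, ?_⟩
    have hκ0' : algebraMap K L κ ≠ 0 := by simpa using hκ0
    simp only [map_div₀, map_mul, map_sub, map_ofNat, hx, h]
    field_simp
    ring
  have htint : IsIntegral ℤ t := ⟨X ^ 5 - X - 1, by monicity!, by simp [ht]⟩
  obtain ⟨T, hT⟩ : ∃ T : 𝓞 K, algebraMap (𝓞 K) K T = t := ⟨⟨t, htint⟩, rfl⟩
  let S : 𝓞 K := 1 - T ^ 2 - T ^ 3 + T ^ 4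
  let N : 𝓞 K := 1 - T + T ^ 2 + 4 * T ^ 3 - 2 * T ^ 4
  have hS : algebraMap (𝓞 K) K S = s := by simp [S, s, hT]
  have hN : algebraMap (𝓞 K) K N = n := by
    simp [N, n, hT, map_ofNat (algebraMap (𝓞 K) K)]
  let P : (𝓞 K)[X] := X ^ 2 - C S * X + C N
  have hP : P.Monic := by simp only [P]; monicity!
  have hPd : P.natDegree = 2 := by simp only [P]; compute_degree!
  have h_int : IsIntegral ℤ h := by
    refine isIntegral_trans (A := 𝓞 K) h ⟨P, hP, ?_⟩
    simp [P, IsScalarTower.algebraMap_apply (𝓞 K) K L, hS, hN, hh]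
  obtain ⟨H, hH⟩ : ∃ H : 𝓞 L, algebraMap (𝓞 L) L H = h := ⟨⟨h, h_int⟩, rfl⟩
  have hT' : algebraMap (𝓞 L) L (algebraMap (𝓞 K) (𝓞 L) T) = algebraMap K L t := by
    rw [← IsScalarTower.algebraMap_apply, IsScalarTower.algebraMap_apply (𝓞 K) K L, hT]
  have hnorm (x y : Quint ℤ) : Ideal.absNorm (Ideal.span
      {x.eval (Int.castRingHom (𝓞 L)) (algebraMap (𝓞 K) (𝓞 L) T) +
        y.eval (Int.castRingHom (𝓞 L)) (algebraMap (𝓞 K) (𝓞 L) T) * H}) =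
        (relNorm x y).norm.natAbs := by
    refine absNorm_span_singleton_eq_natAbs ?_
    have h₁ (z : Quint ℤ) : algebraMap (𝓞 L) L
        (z.eval (Int.castRingHom (𝓞 L)) (algebraMap (𝓞 K) (𝓞 L) T)) =
          algebraMap K L (z.eval (Int.castRingHom K) t) := by
      rw [Quint.map_eval, Quint.map_eval, hT']
      congr 1
      exact RingHom.ext_int _ _
    rw [map_add, map_mul, h₁, h₁, hH, ← Algebra.norm_norm (S := K),
      norm_add_mul_of_sq_eq hL hhK hh, ← Quint.norm_eval b hb ht]
    congr 1
    simp only [relNorm, Quint.eval_add, Quint.eval_mul _ ht, Quint.eval_mk,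
      Int.coe_castRingHom, s, n]
    push_cast
    ring
  have hHsq : H ^ 2 = algebraMap (𝓞 K) (𝓞 L) S * H - algebraMap (𝓞 K) (𝓞 L) N := by
    refine FaithfulSMul.algebraMap_injective (𝓞 L) L ?_
    simp only [map_sub, map_mul, map_pow, hH, ← IsScalarTower.algebraMap_apply (𝓞 K) (𝓞 L) L]
    rw [IsScalarTower.algebraMap_apply (𝓞 K) K L, IsScalarTower.algebraMap_apply (𝓞 K) K L, hS, hN,
      hh]
  have hTpow : algebraMap (𝓞 K) (𝓞 L) T ^ 5 = algebraMap (𝓞 K) (𝓞 L) T + 1 := by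
    rw [← map_pow, show T ^ 5 = T + 1 from RingOfIntegers.ext (by simpa [hT] using ht)]
    simp
  refine ⟨algebraMap (𝓞 K) (𝓞 L) T, H, hTpow, ?_, hnorm, fun x => ?_, ?_⟩
  · rw [hHsq]
    simp [S, N, map_ofNat (algebraMap (𝓞 K) (𝓞 L))]
  · rw [Ideal.absNorm_span_singleton]
    exact natAbs_norm_ne_of_sq_eq hr x
  · have := isTotallyComplex_of_sq_eq hr
    refine exists_mk0_eq_of_discr_le ?_ (by rw [← finrank_mul_finrank ℚ K L, hK, hL])
    have hmin : minpoly (𝓞 K) H = P := by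
      refine (eq_of_monic_of_dvd_of_natDegree_le (minpoly.monic (Algebra.IsIntegral.isIntegral H))
        hP (minpoly.isIntegrallyClosed_dvd (Algebra.IsIntegral.isIntegral H) ?_) ?_).symm
      · simp [P, hHsq]
      · rw [hPd]
        refine (minpoly.two_le_natDegree_iff (Algebra.IsIntegral.isIntegral H)).2 ?_
        rintro ⟨x, hx⟩
        refine hhK ⟨algebraMap (𝓞 K) K x, ?_⟩
        rw [← hH, ← hx, ← IsScalarTower.algebraMap_apply, ← IsScalarTower.algebraMap_apply]
    have htop : Algebra.adjoin K {algebraMap (𝓞 L) L H} = ⊤ := by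
      obtain ⟨c, hc⟩ := exists_basis_eq_pair hL hhK
      rw [hH]
      refine eq_top_iff.2 fun x _ => ?_
      rw [← c.sum_repr x]
      simp only [Fin.sum_univ_two, hc, Matrix.cons_val_zero, Matrix.cons_val_one]
      exact add_mem (Subalgebra.smul_mem _ (one_mem _) _)
        (Subalgebra.smul_mem _ (Algebra.self_mem_adjoin_singleton K h) _)
    have hmem := aeval_derivative_mem_differentIdeal (𝓞 K) K L H htop
    rw [natAbs_discr_eq_absNorm_differentIdeal_mul_natAbs_discr_pow K (𝓞 K) L (𝓞 L), hL]
    refine Nat.mul_le_mul ?_ (Nat.pow_le_pow_left (natAbs_discr_le_of_quintic b hb ht) 2)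
    have hdvd := Ideal.absNorm_dvd_absNorm_of_le ((Ideal.span_singleton_le_iff_mem _).2 hmem)
    refine Nat.le_of_dvd (by norm_num) (hdvd.trans (dvd_of_eq ?_))
    have := hnorm ⟨-1, 0, 1, 1, -1⟩ ⟨2, 0, 0, 0, 0⟩
    have h₂ : aeval H (derivative (minpoly (𝓞 K) H)) =
        Quint.eval (Int.castRingHom (𝓞 L)) (algebraMap (𝓞 K) (𝓞 L) T) ⟨-1, 0, 1, 1, -1⟩ +
          Quint.eval (Int.castRingHom (𝓞 L)) (algebraMap (𝓞 K) (𝓞 L) T) ⟨2, 0, 0, 0, 0⟩ * H := by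
      have h₃ : derivative P = 2 * X - C S := by
        simp only [P, derivative_add, derivative_sub, derivative_X_pow, derivative_C_mul,
          derivative_X, derivative_C]
        simp [show (C 2 : (𝓞 K)[X]) = 2 from map_ofNat C 2]
      rw [hmin, h₃, map_sub, map_mul, map_ofNat (aeval H), aeval_X, aeval_C]
      simp [S, Quint.eval_mk]
      ring
    rw [h₂, this]
    rfl

end fields

section classes

open nonZeroDivisors

variable {R : Type*} [CommRing R] [IsDedekindDomain R]

/-- The ideal `J` is nonzero and its class lies in `H`. -/
def HasClassIn (H : Subgroup (ClassGroup R)) (J : Ideal R) : Prop :=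
  ∃ hJ : J ∈ (Ideal R)⁰, ClassGroup.mk0 ⟨J, hJ⟩ ∈ H

namespace HasClassIn

variable {H : Subgroup (ClassGroup R)} {I J : Ideal R}

theorem mul (hI : HasClassIn H I) (hJ : HasClassIn H J) : HasClassIn H (I * J) := by
  obtain ⟨hI, hI'⟩ := hI
  obtain ⟨hJ, hJ'⟩ := hJ
  refine ⟨mul_mem hI hJ, ?_⟩
  have h := H.mul_mem hI' hJ'
  rwa [← map_mul] at h

theorem of_mul_left (hJ : HasClassIn H J) (hIJ : HasClassIn H (I * J)) : HasClassIn H I := by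
  obtain ⟨hJ, hJ'⟩ := hJ
  obtain ⟨hIJ, hIJ'⟩ := hIJ
  have hI : I ∈ (Ideal R)⁰ := mem_nonZeroDivisors_of_ne_zero fun h ↦ by simp [h] at hIJ
  refine ⟨hI, (H.mul_mem_cancel_right hJ').1 ?_⟩
  rwa [← map_mul]

theorem span_singleton {x : R} (hx : x ≠ 0) : HasClassIn H (Ideal.span {x}) := by
  have h : Ideal.span {x} ∈ (Ideal R)⁰ := mem_nonZeroDivisors_of_ne_zero <| by simpa using hx
  refine ⟨h, ?_⟩
  rw [(ClassGroup.mk0_eq_one_iff h).2 ⟨x, rfl⟩]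
  exact H.one_mem

theorem top : HasClassIn H (⊤ : Ideal R) := by
  rw [← Ideal.span_singleton_one]
  exact span_singleton one_ne_zero

/-- If `H` contains the classes of all primes dividing `J`, it contains the class of `J`. -/
theorem of_forall_prime (hJ : J ≠ ⊥)
    (h : ∀ P : Ideal R, P.IsPrime → P ≠ ⊥ → P ∣ J → HasClassIn H P) : HasClassIn H J := by
  induction J using UniqueFactorizationMonoid.induction_on_prime with
  | h₁ => exact absurd rfl hJ
  | h₂ J hu => rw [Ideal.isUnit_iff.1 hu]; exact top
  | h₃ J P hJ₀ hP ih =>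
    exact (h P (Ideal.isPrime_of_prime hP) hP.ne_zero (dvd_mul_right _ _)).mul
      (ih hJ₀ fun Q hQ hQ₀ hQJ ↦ h Q hQ hQ₀ (hQJ.mul_left _))

end HasClassIn

end classes

section generators

variable {R : Type*} [CommRing R]

/-- A root `halfRoot t h` of `X² - X + 38`. -/
def halfRoot (t h : R) : R :=
  (-t - t ^ 2 + 2 * t ^ 3) + (2 + 2 * t ^ 2 - t ^ 3) * h

variable [IsDedekindDomain R] [Module.Free ℤ R]

/-- `R` behaves like the ring of integers `ℤ[t, h]` of the field defined by
`t ^ 5 - t - 1` and `X ^ 2 - s X + n`. -/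
structure IsGenerator (t h : R) : Prop where
  root : t ^ 5 = t + 1
  sq : h ^ 2 = (1 - t ^ 2 - t ^ 3 + t ^ 4) * h - (1 - t + t ^ 2 + 4 * t ^ 3 - 2 * t ^ 4)
  absNorm_span (x y : Quint ℤ) :
    Ideal.absNorm (Ideal.span {x.eval (Int.castRingHom R) t + y.eval (Int.castRingHom R) t * h}) =
      (relNorm x y).norm.natAbs

namespace IsGenerator

variable {t h : R}

theorem conj (g : IsGenerator t h) : IsGenerator t (1 - t ^ 2 - t ^ 3 + t ^ 4 - h) where
  root := g.root
  sq := by linear_combination g.sq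
  absNorm_span x y := by
    have hN : relNorm (x.add (y.mul ⟨1, 0, -1, -1, 1⟩)) ⟨-y.c₀, -y.c₁, -y.c₂, -y.c₃, -y.c₄⟩ =
        relNorm x y := by
      ext <;> simp only [relNorm, Quint.add, Quint.mul] <;> ring
    rw [← hN, ← g.absNorm_span, Quint.eval_add, Quint.eval_mul _ g.root]
    congr 3
    simp only [Quint.eval, map_neg, map_one, map_zero]
    ring

theorem halfRoot_sq (g : IsGenerator t h) : halfRoot t h ^ 2 = halfRoot t h - 38 := by
  unfold halfRoot
  linear_combination (4 + 8 * t ^ 2 - 4 * t ^ 3 + 4 * t ^ 4 - 4 * t ^ 5 + t ^ 6) * g.sq +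
    ((-34 + 29 * t - 19 * t ^ 2 + 23 * t ^ 3 - 12 * t ^ 4 + 2 * t ^ 5) +
    (-2 + 6 * t - 4 * t ^ 2 + 7 * t ^ 3 - 5 * t ^ 4 + t ^ 5) * h) * g.root

theorem halfRoot_conj (g : IsGenerator t h) :
    halfRoot t (1 - t ^ 2 - t ^ 3 + t ^ 4 - h) = 1 - halfRoot t h := by
  unfold halfRoot
  linear_combination (-1 + 3 * t - t ^ 2) * g.root

theorem absNorm_span_ten_sub_halfRoot (g : IsGenerator t h) :
    Ideal.absNorm (Ideal.span {10 - halfRoot t h}) = 2 ^ 35 := by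
  have H := g.absNorm_span ⟨10, 1, 1, -2, 0⟩ ⟨-2, 0, -2, 1, 0⟩
  rw [show (relNorm ⟨10, 1, 1, -2, 0⟩ ⟨-2, 0, -2, 1, 0⟩).norm.natAbs = 2 ^ 35 by decide +kernel]
    at H
  rw [← H]
  congr 3
  simp [Quint.eval, halfRoot]
  ring

theorem span_mul_span_conj (g : IsGenerator t h) :
    Ideal.span {2, halfRoot t h} * Ideal.span {2, 1 - halfRoot t h} = Ideal.span {2} := by
  rw [Ideal.span_pair_mul_span_pair]
  apply le_antisymm
  · simp only [Ideal.span_le, Set.insert_subset_iff, Set.singleton_subset_iff, SetLike.mem_coe,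
      Ideal.mem_span_singleton]
    exact ⟨dvd_mul_right _ _, dvd_mul_right _ _, dvd_mul_left _ _,
      ⟨19, by linear_combination -g.halfRoot_sq⟩⟩
  · rw [Ideal.span_singleton_le_iff_mem]
    have h₁ : 2 * (1 - halfRoot t h) ∈
        Ideal.span {2 * 2, 2 * (1 - halfRoot t h), halfRoot t h * 2, halfRoot t h * (1 - halfRoot
          t h)} :=
      Ideal.subset_span (by simp)
    have h₂ : halfRoot t h * 2 ∈
        Ideal.span {2 * 2, 2 * (1 - halfRoot t h), halfRoot t h * 2, halfRoot t h * (1 - halfRoot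
          t h)} :=
      Ideal.subset_span (by simp)
    convert add_mem h₁ h₂ using 1
    ring

theorem span_pow_seven (g : IsGenerator t h) :
    Ideal.span {2, halfRoot t h} ^ 7 = Ideal.span {10 - halfRoot t h} := by
  have key : Ideal.span {2, halfRoot t h} ^ 7 * Ideal.span {2, 1 - halfRoot t h} ^ 7 =
      Ideal.span {10 - halfRoot t h} * Ideal.span {9 + halfRoot t h} := by
    rw [← mul_pow, g.span_mul_span_conj, Ideal.span_singleton_pow,
      Ideal.span_singleton_mul_span_singleton]
    congr 2
    linear_combination g.halfRoot_sq
  have h₁ : IsCoprime (Ideal.span {10 - halfRoot t h}) (Ideal.span {2, 1 - halfRoot t h}) := by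
    rw [Ideal.isCoprime_iff_exists]
    refine ⟨_, Ideal.mem_span_singleton_self _, -(1 - halfRoot t h) - 2 * 4, ?_, by ring⟩
    exact sub_mem (neg_mem (Ideal.subset_span (by simp)))
      (Ideal.mul_mem_right _ _ (Ideal.subset_span (by simp)))
  have h₂ : IsCoprime (Ideal.span {2, halfRoot t h}) (Ideal.span {9 + halfRoot t h}) := by
    rw [Ideal.isCoprime_iff_exists]
    refine ⟨-halfRoot t h - 2 * 4, ?_, _, Ideal.mem_span_singleton_self _, by ring⟩
    exact sub_mem (neg_mem (Ideal.subset_span (by simp)))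
      (Ideal.mul_mem_right _ _ (Ideal.subset_span (by simp)))
  exact dvd_antisymm (h₂.pow_left.dvd_of_dvd_mul_right ⟨_, key.symm⟩)
    (h₁.pow_right.dvd_of_dvd_mul_right ⟨_, key⟩)

theorem span_four_mul (g : IsGenerator t h) :
    Ideal.span {1 + t + t ^ 2, halfRoot t h} * Ideal.span {2, halfRoot t h} =
      Ideal.span {(-1 + t + t ^ 2 + t ^ 3 - t ^ 4) + (t + t ^ 2 - t ^ 4) * h} := by
  rw [Ideal.span_pair_mul_span_pair]
  apply le_antisymm
  · simp only [Ideal.span_le, Set.insert_subset_iff, Set.singleton_subset_iff, SetLike.mem_coe,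
      Ideal.mem_span_singleton]
    refine ⟨⟨(-6 - 2 * t + 9 * t ^ 2 + 5 * t ^ 3 - 5 * t ^ 4) +
        (1 - 2 * t ^ 2 - t ^ 3 + t ^ 4) * h, ?_⟩,
      ⟨(12 + 32 * t + 16 * t ^ 2 - 20 * t ^ 3 - 16 * t ^ 4) +
        (-3 - 5 * t - 2 * t ^ 2 + 5 * t ^ 3 + 4 * t ^ 4) * h, ?_⟩,
      ⟨(24 + 16 * t - 32 * t ^ 2 - 24 * t ^ 3 + 24 * t ^ 4) +
        (-7 - t + 7 * t ^ 2 + 4 * t ^ 3 - 3 * t ^ 4) * h, ?_⟩,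
      ⟨(-26 - 125 * t - 73 * t ^ 2 + 83 * t ^ 3 + 69 * t ^ 4) +
        (6 + 28 * t + 13 * t ^ 2 - 17 * t ^ 3 - 11 * t ^ 4) * h, ?_⟩⟩
    · linear_combination ((-t - t ^ 2 + 2 * t ^ 3 + 4 * t ^ 4 - 3 * t ^ 6 - t ^ 7 + t ^ 8)) * g.sq
      + ((4 - 11 * t - 8 * t ^ 2 + 6 * t ^ 3 + 14 * t ^ 4 - 3 * t ^ 5 - 6 * t ^ 6 + 2 * t ^ 7) + (-1
      - 3 * t - t ^ 2 + 5 * t ^ 3 + 4 * t ^ 4 - 3 * t ^ 5 - 2 * t ^ 6 + t ^ 7) * h) * g.root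
    · unfold halfRoot
      linear_combination ((3 * t + 8 * t ^ 2 + 7 * t ^ 3 - 6 * t ^ 4 - 14 * t ^ 5 - 6 * t ^ 6 + 5
        * t ^ 7 + 4 * t ^ 8)) * g.sq + ((-12 - 4 * t + 39 * t ^ 2 + 43 * t ^ 3 - 5 * t ^ 4 - 36 * t
        ^ 5 - 6 * t ^ 6 + 8 * t ^ 7) + (1 + 8 * t + 18 * t ^ 2 + 10 * t ^ 3 - 13 * t ^ 4 - 15 * t ^
        5 + t ^ 6 + 4 * t ^ 7) * h) * g.root
    · unfold halfRoot
      linear_combination ((7 * t + 8 * t ^ 2 - 6 * t ^ 3 - 18 * t ^ 4 - 2 * t ^ 5 + 10 * t ^ 6 + 4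
        * t ^ 7 - 3 * t ^ 8)) * g.sq + ((-24 + 41 * t + 34 * t ^ 2 - 13 * t ^ 3 - 51 * t ^ 4 + 7 * t
        ^ 5 + 20 * t ^ 6 - 6 * t ^ 7) + (3 + 8 * t + 5 * t ^ 2 - 11 * t ^ 3 - 16 * t ^ 4 + 9 * t ^ 5
        + 7 * t ^ 6 - 3 * t ^ 7) * h) * g.root
    · unfold halfRoot
      linear_combination ((4 - 6 * t - 26 * t ^ 2 - 45 * t ^ 3 + 14 * t ^ 4 + 52 * t ^ 5 + 25 * t
        ^ 6 - 17 * t ^ 7 - 11 * t ^ 8)) * g.sq + ((30 + 59 * t - 154 * t ^ 2 - 164 * t ^ 3 + 10 * t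
        ^ 4 + 129 * t ^ 5 + 10 * t ^ 6 - 22 * t ^ 7) + (-10 - 28 * t - 68 * t ^ 2 - 27 * t ^ 3 + 44
        * t ^ 4 + 53 * t ^ 5 - 6 * t ^ 6 - 11 * t ^ 7) * h) * g.root
  · rw [Ideal.span_singleton_le_iff_mem]
    simp only [Ideal.mem_span_insert, Ideal.mem_span_singleton']
    refine ⟨(6 - 6 * t + 8 * t ^ 2 - 7 * t ^ 3 - 3 * t ^ 4) +
        (-1 + t + t ^ 2 + t ^ 3 + t ^ 4) * h, _,
      ⟨(-t ^ 2 - t ^ 4) + (-t - t ^ 2) * h, _, ⟨0, _, ⟨t ^ 2, rfl⟩, rfl⟩, rfl⟩, ?_⟩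
    unfold halfRoot
    linear_combination ((2 * t + 6 * t ^ 3 - 3 * t ^ 4 + 6 * t ^ 5 - 4 * t ^ 6 + 3 * t ^ 7 - t ^
      8)) * g.sq + ((13 - 12 * t + 25 * t ^ 2 - 27 * t ^ 3 + 26 * t ^ 4 - 19 * t ^ 5 + 10 * t ^ 6 -
      2 * t ^ 7) + (-2 - t + t ^ 2 - 2 * t ^ 3 + 6 * t ^ 4 - 6 * t ^ 5 + 4 * t ^ 6 - t ^ 7) * h) *
      g.root

theorem span_eight_mul (g : IsGenerator t h) :
    Ideal.span {1 + t ^ 2 + t ^ 3, halfRoot t h} * Ideal.span {1 + t + t ^ 2, halfRoot t h} =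
      Ideal.span {2, halfRoot t h} := by
  rw [Ideal.span_pair_mul_span_pair]
  apply le_antisymm
  · simp only [Ideal.span_le, Set.insert_subset_iff, Set.singleton_subset_iff, SetLike.mem_coe]
    have hw : halfRoot t h ∈ Ideal.span {2, halfRoot t h} := Ideal.subset_span (by simp)
    refine ⟨?_, Ideal.mul_mem_left _ _ hw, Ideal.mul_mem_right _ _ hw, Ideal.mul_mem_right _ _ hw⟩
    rw [show (1 + t ^ 2 + t ^ 3) * (1 + t + t ^ 2) = 2 * (1 + t + t ^ 2 + t ^ 3 + t ^ 4) by
      linear_combination g.root]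
    exact Ideal.mul_mem_right _ _ (Ideal.subset_span (by simp))
  · rw [Ideal.span_le, Set.insert_subset_iff, Set.singleton_subset_iff]
    simp only [SetLike.mem_coe, Ideal.mem_span_insert, Ideal.mem_span_singleton']
    refine ⟨⟨2 - t ^ 4, _, ⟨0, _, ⟨0, _, ⟨0, rfl⟩, rfl⟩, rfl⟩, ?_⟩,
      ⟨0, _, ⟨-t, _, ⟨t ^ 3, _, ⟨0, rfl⟩, rfl⟩, rfl⟩, ?_⟩⟩
    · linear_combination (2 * t + 2 * t ^ 2 + 2 * t ^ 3 + t ^ 4) * g.root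
    · linear_combination -halfRoot t h * g.root

theorem absNorm_span_two (g : IsGenerator t h) :
    Ideal.absNorm (Ideal.span {2, halfRoot t h}) = 32 := by
  have H : Ideal.absNorm (Ideal.span {2, halfRoot t h}) ^ 7 = 32 ^ 7 := by
    rw [← map_pow, g.span_pow_seven, g.absNorm_span_ten_sub_halfRoot]
    norm_num
  exact Nat.pow_left_injective (by norm_num : 7 ≠ 0) H

theorem absNorm_span_four_mul (g : IsGenerator t h) :
    Ideal.absNorm (Ideal.span {(-1 + t + t ^ 2 + t ^ 3 - t ^ 4) + (t + t ^ 2 - t ^ 4) * h}) =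
      128 := by
  have H := g.absNorm_span ⟨-1, 1, 1, 1, -1⟩ ⟨0, 1, 1, 0, -1⟩
  rw [show (relNorm ⟨-1, 1, 1, 1, -1⟩ ⟨0, 1, 1, 0, -1⟩).norm.natAbs = 128 by decide +kernel]
    at H
  rw [← H]
  congr 3
  simp [Quint.eval]
  ring

theorem absNorm_span_four (g : IsGenerator t h) :
    Ideal.absNorm (Ideal.span {1 + t + t ^ 2, halfRoot t h}) = 4 := by
  have H := congrArg Ideal.absNorm g.span_four_mul
  rw [map_mul, g.absNorm_span_two, g.absNorm_span_four_mul] at H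
  omega

theorem absNorm_span_eight (g : IsGenerator t h) :
    Ideal.absNorm (Ideal.span {1 + t ^ 2 + t ^ 3, halfRoot t h}) = 8 := by
  have H := congrArg Ideal.absNorm g.span_eight_mul
  rw [map_mul, g.absNorm_span_two, g.absNorm_span_four] at H
  omega

end IsGenerator

end generators

namespace SmoothCert

theorem covered_of_lt {p f : ℕ} (hp : p.Prime) (hf : f ≠ 0) (hq : p ^ f < 6464)
    (h₄ : p ^ f ≠ 4) (h₈ : p ^ f ≠ 8) : covered p f = true := by
  obtain rfl | hf₁ := eq_or_ne f 1
  · rw [pow_one] at hq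
    have h := List.all_eq_true.1 covered_one p (List.mem_range.2 hq)
    rw [Bool.or_eq_true, Bool.or_eq_true] at h
    rcases h with (h | h) | h
    · exact absurd (Nat.le_of_ble_eq_true h) hp.one_lt.not_ge
    · obtain ⟨d, hd, h⟩ := List.any_eq_true.1 h
      rw [Bool.and_eq_true, Bool.not_eq_true'] at h
      rcases (Nat.dvd_prime hp).1 (Nat.dvd_of_mod_eq_zero (Nat.eq_of_beq_eq_true h.1))
        with rfl | rfl
      · simp [smallPrimes] at hd
      · exact absurd rfl (Nat.ne_of_beq_eq_false h.2)
    · exact h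
  · have hf₂ : 2 ≤ f := by omega
    have hp₂ : p < 81 := by
      have := Nat.pow_le_pow_right hp.pos hf₂
      nlinarith
    have hs : p ∈ smallPrimes := by
      have : ∀ p < 81, p.Prime → p ∈ smallPrimes := by decide +kernel
      exact this p hp₂ hp
    have hf₃ : f < 13 := by
      have h₁ := Nat.pow_le_pow_left hp.two_le f
      exact (Nat.pow_lt_pow_iff_right one_lt_two).1 (by norm_num; omega : 2 ^ f < 2 ^ 13)
    have h := List.all_eq_true.1 (List.all_eq_true.1 covered_of_two_le p hs) f
      (List.mem_range.2 hf₃)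
    simp only [Bool.or_eq_true] at h
    rcases h with (((h | h) | h) | h) | h
    · exact absurd (Nat.le_of_ble_eq_true h) (by omega)
    · exact absurd (Nat.le_of_ble_eq_true h) hq.not_ge
    · exact absurd (Nat.eq_of_beq_eq_true h) h₄
    · exact absurd (Nat.eq_of_beq_eq_true h) h₈
    · exact h

end SmoothCert

theorem not_isPrimePow_6464 : ¬ IsPrimePow 6464 := by
  rw [isPrimePow_iff_unique_prime_dvd]
  rintro ⟨p, -, hp⟩
  have h₁ := hp 2 ⟨by norm_num, by norm_num⟩
  have h₂ := hp 101 ⟨by norm_num, by norm_num⟩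
  omega

section absNorm

variable {R : Type*} [CommRing R] [IsDedekindDomain R] [Module.Free ℤ R]

theorem Ideal.eq_of_le_of_absNorm_eq {I J : Ideal R} (h : I ≤ J)
    (hN : Ideal.absNorm I = Ideal.absNorm J) (h₀ : Ideal.absNorm J ≠ 0) : I = J := by
  obtain ⟨M, rfl⟩ := Ideal.dvd_iff_le.2 h
  rw [map_mul] at hN
  rw [Ideal.absNorm_eq_one_iff.1 (Nat.eq_of_mul_eq_mul_left (Nat.pos_of_ne_zero h₀)
    (hN.trans (mul_one _).symm)), Ideal.mul_top]

theorem Ideal.pow_absNorm_sub_mem {P : Ideal R} [P.IsPrime] (h₀ : Ideal.absNorm P ≠ 0) (x : R) :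
    x ^ Ideal.absNorm P - x ∈ P := by
  have := (Ideal.absNorm_ne_zero_iff P).1 h₀
  have := Fintype.ofFinite (R ⧸ P)
  have := Ideal.Quotient.maximal_of_isField P (Finite.isField_of_domain _)
  let := Ideal.Quotient.field P
  rw [← Ideal.Quotient.eq, map_pow, Ideal.absNorm_apply, Submodule.cardQuot_apply,
    Nat.card_eq_fintype_card, FiniteField.pow_card]

end absNorm

namespace IsGenerator

variable {R : Type*} [CommRing R] [IsDedekindDomain R] [Module.Free ℤ R] {t h : R}
  {H : Subgroup (ClassGroup R)} {P : Ideal R}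

theorem hasClassIn_span_conj (g : IsGenerator t h)
    (hH : HasClassIn H (Ideal.span {2, halfRoot t h})) :
    HasClassIn H (Ideal.span {2, halfRoot t (1 - t ^ 2 - t ^ 3 + t ^ 4 - h)}) := by
  refine hH.of_mul_left ?_
  rw [g.halfRoot_conj, mul_comm, g.span_mul_span_conj]
  refine HasClassIn.span_singleton fun h₂ ↦ ?_
  have hN := congrArg Ideal.absNorm g.span_mul_span_conj
  rw [map_mul, ← g.halfRoot_conj, g.absNorm_span_two, g.conj.absNorm_span_two] at hN
  simp [h₂] at hN

theorem hasClassIn_span_four (g : IsGenerator t h)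
    (hH : HasClassIn H (Ideal.span {2, halfRoot t h})) :
    HasClassIn H (Ideal.span {1 + t + t ^ 2, halfRoot t h}) := by
  refine hH.of_mul_left ?_
  rw [g.span_four_mul]
  refine HasClassIn.span_singleton fun h₀ ↦ ?_
  have := g.absNorm_span_four_mul
  simp [h₀] at this

theorem hasClassIn_span_eight (g : IsGenerator t h)
    (hH : HasClassIn H (Ideal.span {2, halfRoot t h})) :
    HasClassIn H (Ideal.span {1 + t ^ 2 + t ^ 3, halfRoot t h}) := by
  refine (g.hasClassIn_span_four hH).of_mul_left ?_
  rwa [g.span_eight_mul]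

/-- A prime above `2` contains `halfRoot t h` or its conjugate. -/
theorem halfRoot_mem_or (g : IsGenerator t h) [hP : P.IsPrime] (h₂ : (2 : R) ∈ P) :
    halfRoot t h ∈ P ∨ halfRoot t (1 - t ^ 2 - t ^ 3 + t ^ 4 - h) ∈ P := by
  refine hP.mem_or_mem ?_
  rw [g.halfRoot_conj, show halfRoot t h * (1 - halfRoot t h) = 2 * 19 by
    linear_combination -g.halfRoot_sq]
  exact P.mul_mem_right _ h₂

theorem hasClassIn_of_absNorm_eq_four (g : IsGenerator t h)
    (hH : HasClassIn H (Ideal.span {2, halfRoot t h})) [hP : P.IsPrime]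
    (hN : Ideal.absNorm P = 4) : HasClassIn H P := by
  have h₂ : (2 : R) ∈ P := hP.mem_of_pow_mem 2 (by
    have := Ideal.absNorm_mem P
    rw [hN] at this
    convert this using 1
    norm_num)
  have h₄ : 1 + t + t ^ 2 ∈ P := by
    have ht := Ideal.pow_absNorm_sub_mem (P := P) (by simp [hN]) t
    rw [hN] at ht
    convert P.add_mem (P.mul_mem_left t ht) (P.mul_mem_right (t ^ 2) h₂) using 1
    linear_combination -g.root
  rcases g.halfRoot_mem_or h₂ with hw | hw
  · have hle : Ideal.span {1 + t + t ^ 2, halfRoot t h} ≤ P := by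
      simp [Ideal.span_le, Set.insert_subset_iff, h₄, hw]
    rw [← Ideal.eq_of_le_of_absNorm_eq hle (by rw [hN, g.absNorm_span_four]) (by simp [hN])]
    exact g.hasClassIn_span_four hH
  · have hle : Ideal.span {1 + t + t ^ 2, halfRoot t (1 - t ^ 2 - t ^ 3 + t ^ 4 - h)} ≤ P := by
      simp [Ideal.span_le, Set.insert_subset_iff, h₄, hw]
    rw [← Ideal.eq_of_le_of_absNorm_eq hle (by rw [hN, g.conj.absNorm_span_four]) (by simp [hN])]
    exact g.conj.hasClassIn_span_four (g.hasClassIn_span_conj hH)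

theorem hasClassIn_of_absNorm_eq_eight (g : IsGenerator t h)
    (hH : HasClassIn H (Ideal.span {2, halfRoot t h})) [hP : P.IsPrime]
    (hN : Ideal.absNorm P = 8) : HasClassIn H P := by
  have h₂ : (2 : R) ∈ P := hP.mem_of_pow_mem 3 (by
    have := Ideal.absNorm_mem P
    rw [hN] at this
    convert this using 1
    norm_num)
  have h₈ : 1 + t ^ 2 + t ^ 3 ∈ P := by
    have ht := Ideal.pow_absNorm_sub_mem (P := P) (by simp [hN]) t
    rw [hN] at ht
    convert P.add_mem (P.mul_mem_left (1 + t) ht) (P.mul_mem_right (t ^ 2 - t ^ 4) h₂) using 1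
    linear_combination (-1 - t ^ 3 - t ^ 4) * g.root
  rcases g.halfRoot_mem_or h₂ with hw | hw
  · have hle : Ideal.span {1 + t ^ 2 + t ^ 3, halfRoot t h} ≤ P := by
      simp [Ideal.span_le, Set.insert_subset_iff, h₈, hw]
    rw [← Ideal.eq_of_le_of_absNorm_eq hle (by rw [hN, g.absNorm_span_eight]) (by simp [hN])]
    exact g.hasClassIn_span_eight hH
  · have hle : Ideal.span {1 + t ^ 2 + t ^ 3, halfRoot t (1 - t ^ 2 - t ^ 3 + t ^ 4 - h)} ≤ P := by
      simp [Ideal.span_le, Set.insert_subset_iff, h₈, hw]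
    rw [← Ideal.eq_of_le_of_absNorm_eq hle (by rw [hN, g.conj.absNorm_span_eight]) (by simp [hN])]
    exact g.conj.hasClassIn_span_eight (g.hasClassIn_span_conj hH)

variable [Module.Finite ℤ R]

theorem exists_absNorm_eq_pow (hP : P.IsPrime) (h₀ : P ≠ ⊥) :
    ∃ p f : ℕ, p.Prime ∧ f ≠ 0 ∧ CharP (R ⧸ P) p ∧ Ideal.absNorm P = p ^ f := by
  have := Ideal.finiteQuotientOfFreeOfNeBot P h₀
  have := Fintype.ofFinite (R ⧸ P)
  have := hP.isMaximal h₀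
  let := Ideal.Quotient.field P
  obtain ⟨p, hc, n, hp, hn⟩ := FiniteField.card' (R ⧸ P)
  exact ⟨p, n, hp, n.ne_zero, hc, by
    rw [Ideal.absNorm_apply, Submodule.cardQuot_apply, Nat.card_eq_fintype_card, hn]⟩

/-- A covered prime divides a principal ideal all of whose other prime factors have smaller norm. -/
theorem exists_mul_eq_span (g : IsGenerator t h) (hP : P.IsPrime) (h₀ : P ≠ ⊥) {p f : ℕ}
    (hp : p.Prime) (hc : CharP (R ⧸ P) p) (hN : Ideal.absNorm P = p ^ f)
    (hcov : SmoothCert.covered p f = true) :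
    ∃ (J : Ideal R) (x : R), P * J = Ideal.span {x} ∧ x ≠ 0 ∧
      ∀ Q : Ideal R, Q.IsPrime → Q ≠ ⊥ → Q ∣ J → Ideal.absNorm Q < Ideal.absNorm P := by
  have := Ideal.finiteQuotientOfFreeOfNeBot P h₀
  have := hP.isMaximal h₀
  let := Ideal.Quotient.field P
  have hq : Nat.card (R ⧸ P) = p ^ f := by
    rw [← hN, Ideal.absNorm_apply, Submodule.cardQuot_apply]
  have ht : Ideal.Quotient.mk P t ^ 5 = Ideal.Quotient.mk P t + 1 := by
    rw [← map_pow, g.root, map_add, map_one]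
  have hz : Ideal.Quotient.mk P (2 * halfRoot t h - 1) ^ 2 = -151 := by
    rw [← map_pow, show (2 * halfRoot t h - 1) ^ 2 = -151 by linear_combination 4 * g.halfRoot_sq]
    rw [map_neg, map_ofNat]
  obtain ⟨c, hc₀, hs⟩ := SmoothCert.exists_code_of_covered hcov hp hq ht hz
  have hmem : (SmoothCert.codeNorm c).eval (Int.castRingHom R) t ∈ P := by
    rw [← Ideal.Quotient.eq_zero_iff_mem, Quint.map_eval, ← hc₀]
    congr 1
  have hx : ∃ x ∈ P, Ideal.absNorm (Ideal.span {x}) = (SmoothCert.codeNorm c).norm.natAbs := by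
    rw [SmoothCert.codeNorm, eval_relNorm g.root g.sq] at hmem
    rcases hP.mem_or_mem hmem with hx | hx
    · exact ⟨_, hx, g.absNorm_span _ _⟩
    · exact ⟨_, hx, g.conj.absNorm_span _ _⟩
  obtain ⟨x, hxP, hx⟩ := hx
  obtain ⟨J, hJ⟩ := Ideal.dvd_span_singleton.2 hxP
  have hNJ : p ^ f * Ideal.absNorm J = (SmoothCert.codeNorm c).norm.natAbs := by
    rw [← hx, hJ, map_mul, hN]
  obtain ⟨a, b, hab, h₁, hcop, ha, hb⟩ := SmoothCert.smoothNorm_spec hs ⟨_, hNJ.symm⟩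
  rw [← hNJ, Nat.mul_div_cancel_left _ (pow_pos hp.pos f)] at hab h₁
  refine ⟨J, x, hJ.symm, ?_, fun Q hQ hQ₀ hQJ ↦ ?_⟩
  · rintro rfl
    rw [Set.singleton_zero, Ideal.span_zero, Ideal.absNorm_bot] at hx
    have := Nat.mul_pos (pow_pos hp.pos f) h₁
    omega
  · obtain ⟨r, e, hr, he, -, hQN⟩ := exists_absNorm_eq_pow hQ hQ₀
    have hd := hab ▸ Ideal.absNorm_dvd_absNorm_of_le (Ideal.dvd_iff_le.1 hQJ)
    have hpp : IsPrimePow (Ideal.absNorm Q) := hQN ▸ hr.isPrimePow.pow he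
    have hab₀ : a * b ≠ 0 := by omega
    rw [hN]
    rcases (hcop.isPrimePow_dvd_mul hpp).1 hd with hd | hd
    · exact (Nat.le_of_dvd (Nat.pos_of_ne_zero (left_ne_zero_of_mul hab₀)) hd).trans_lt ha
    · exact (Nat.le_of_dvd (Nat.pos_of_ne_zero (right_ne_zero_of_mul hab₀)) hd).trans_lt hb

theorem hasClassIn_of_isPrime (g : IsGenerator t h)
    (hH : HasClassIn H (Ideal.span {2, halfRoot t h})) (hP : P.IsPrime) (h₀ : P ≠ ⊥)
    (hq : Ideal.absNorm P ≤ 6464) : HasClassIn H P := by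
  induction hN : Ideal.absNorm P using Nat.strong_induction_on generalizing P with
  | _ q ih =>
    subst hN
    obtain ⟨p, f, hp, hf, hc, hpf⟩ := exists_absNorm_eq_pow hP h₀
    by_cases h₄ : Ideal.absNorm P = 4
    · exact g.hasClassIn_of_absNorm_eq_four hH h₄
    by_cases h₈ : Ideal.absNorm P = 8
    · exact g.hasClassIn_of_absNorm_eq_eight hH h₈
    have hlt : p ^ f < 6464 := by
      refine lt_of_le_of_ne (hpf ▸ hq) fun he ↦ not_isPrimePow_6464 ?_
      rw [← he]
      exact hp.isPrimePow.pow hf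
    obtain ⟨J, x, hJ, hx, hlt⟩ := g.exists_mul_eq_span hP h₀ hp hc hpf
      (SmoothCert.covered_of_lt hp hf hlt (hpf ▸ h₄) (hpf ▸ h₈))
    have hJ₀ : J ≠ ⊥ := by
      rintro rfl
      rw [Ideal.mul_bot, eq_comm, Ideal.span_singleton_eq_bot] at hJ
      exact hx hJ
    refine (HasClassIn.of_forall_prime hJ₀ fun Q hQ hQ₀ hQJ ↦ ?_).of_mul_left
      (hJ ▸ HasClassIn.span_singleton hx)
    have hQP := hlt Q hQ hQ₀ hQJ
    exact ih _ hQP hQ hQ₀ (hQP.le.trans hq) rfl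

theorem hasClassIn_of_absNorm_le (g : IsGenerator t h)
    (hH : HasClassIn H (Ideal.span {2, halfRoot t h})) {J : Ideal R} (h₀ : J ≠ ⊥)
    (hJ : Ideal.absNorm J ≤ 6464) : HasClassIn H J :=
  HasClassIn.of_forall_prime h₀ fun _ hP hP₀ hPJ ↦ g.hasClassIn_of_isPrime hH hP hP₀ <|
    (Nat.le_of_dvd (Nat.pos_of_ne_zero (mt Ideal.absNorm_eq_zero_iff.1 h₀))
      (Ideal.absNorm_dvd_absNorm_of_le (Ideal.dvd_iff_le.1 hPJ))).trans hJ

open nonZeroDivisors in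
/-- If every class contains an ideal of norm at most `6464` and no principal ideal has norm `32`,
then the class group has order `7`. -/
theorem card_classGroup (g : IsGenerator t h) (h₃₂ : ∀ x : R, Ideal.absNorm (Ideal.span {x}) ≠ 32)
    (hb : ∀ c, ∃ I : (Ideal R)⁰, ClassGroup.mk0 I = c ∧ Ideal.absNorm (I : Ideal R) ≤ 6464) :
    Nat.card (ClassGroup R) = 7 := by
  have hI : Ideal.span {2, halfRoot t h} ∈ (Ideal R)⁰ := mem_nonZeroDivisors_of_ne_zero fun h₀ ↦ by
    have := g.absNorm_span_two
    simp [h₀] at this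
  set c := ClassGroup.mk0 ⟨_, hI⟩ with hc
  have hc₁ : c ≠ 1 := by
    intro h₁
    obtain ⟨x, hx⟩ := (ClassGroup.mk0_eq_one_iff hI).1 h₁
    exact h₃₂ x (by rw [← g.absNorm_span_two, hx])
  have hc₇ : c ^ 7 = 1 := by
    rw [hc, ← map_pow]
    exact (ClassGroup.mk0_eq_one_iff _).2 ⟨_, g.span_pow_seven⟩
  have htop : Subgroup.zpowers c = ⊤ := by
    refine eq_top_iff.2 fun d _ ↦ ?_
    obtain ⟨J, rfl, hJ⟩ := hb d
    obtain ⟨_, hJ'⟩ := g.hasClassIn_of_absNorm_le (H := Subgroup.zpowers c)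
      ⟨hI, Subgroup.mem_zpowers c⟩ (nonZeroDivisors.coe_ne_zero J) hJ
    exact hJ'
  have : Fact (Nat.Prime 7) := ⟨by norm_num⟩
  rw [← Subgroup.card_top, ← htop, Nat.card_zpowers, orderOf_eq_prime hc₇ hc₁]

end IsGenerator

/-- Let `K = ℚ[X]/(X^5 - X - 1)`, a degree-5 number field, and
`L = K[Y]/(Y² + 151)`, a degree-10 number field. Then the class number of `L` is `7`. -/
theorem classNumber_eq_seven (K L : Type) [Field K] [NumberField K]
    [Field L] [NumberField L] [Algebra K L]
    (eK : K ≃ₐ[ℚ] AdjoinRoot (X ^ 5 - X - 1 : ℚ[X]))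
    (eL : L ≃ₐ[K] AdjoinRoot (X ^ 2 + 151 : K[X])) :
    NumberField.classNumber L = 7 := by
  obtain ⟨t, h, ht, hh, hN, h₃₂, hb⟩ := exists_generators eK eL
  rw [NumberField.classNumber, ← Nat.card_eq_fintype_card]
  exact IsGenerator.card_classGroup ⟨ht, hh, hN⟩ h₃₂ hb
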